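/- arXiv:2402.18300 — 3 statements merged into one kernel-verified Lean document; each statement's English description precedes it below -/
import Mathlib

section
/- (Asymptotic shuffle product formula) For any w_1 ∈ 𝔥^1 and w_0 ∈ 𝔥^0, one has Z_N^♮(w_1)·Z_N^♮(w_0) = Z_N^♮(w_1 ⧢ w_0) + O(N^{−1} log^a N) as N → ∞, for some positive integer a depending only on w_1, w_0. -/
open Finset

open scoped Classical

/-- `ω̂₀^{(N)}(n) = 1/n`, `ω̂₁^{(N)}(n) = 1/(N-n)`. -/
noncomputable def omegaHat (N : ℕ) (u : Bool) (n : ℕ) : ℝ :=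
  if u then 1 / ((N : ℝ) - n) else 1 / n

/-- The word `e_𝐤 ∈ {e₀,e₁}^*` attached to an index `𝐤` (`true` = `e₁`). -/
def wordOf (k : List ℕ) : List Bool :=
  k.flatMap (fun j => true :: List.replicate (j - 1) false)

/-- Auxiliary front-recursion for the shuffle product on reversed words over `{e₀,e₁}`. -/
noncomputable def shR : List Bool → List Bool → (List Bool →₀ ℚ)
  | [], w => Finsupp.single w 1
  | a :: w, [] => Finsupp.single (a :: w) 1
  | a :: w, b :: w' =>
      (shR w (b :: w')).mapDomain (List.cons a)
    + (shR (a :: w) w').mapDomain (List.cons b)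
termination_by w w' => w.length + w'.length
decreasing_by all_goals (simp; try omega)

/-- The shuffle product of two words over `{e₀,e₁}` (`true` = `e₁`): it satisfies
`w u₁ ⧢ w' u₂ = (w ⧢ w' u₂) u₁ + (w u₁ ⧢ w') u₂` and `w ⧢ 1 = 1 ⧢ w = w`. -/
noncomputable def shW (w w' : List Bool) : List Bool →₀ ℚ :=
  (shR w.reverse w'.reverse).mapDomain List.reverse

/-- ℚ-bilinear extension of the shuffle product. -/
noncomputable def shLin (f g : List Bool →₀ ℚ) : List Bool →₀ ℚ :=
  f.sum fun w q => g.sum fun w' q' => (q * q') • shW w w'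

/-- `ζ^♮` attached to a word `u ∈ {e₀,e₁}^*`: sum over strictly increasing tuples
`0 < n₁ < ⋯ < n_k < N` of `∏ ω̂_{u_i}^{(N)}(n_i)`. -/
noncomputable def zetaNatW (N : ℕ) (u : List Bool) : ℝ :=
  ∑ n ∈ Finset.univ.filter
      (fun n : Fin u.length → Fin N => (∀ i, 0 < (n i : ℕ)) ∧ StrictMono n),
    ∏ i, omegaHat N (u.get i) (n i)

/-- `Z_N^♮`: the ℚ-linear map with `Z_N^♮(e_𝐤) = ζ^♮_{<N}(𝐤)`, `Z_N^♮(1) = 1`. -/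
noncomputable def ZNnat (N : ℕ) (f : List Bool →₀ ℚ) : ℝ :=
  f.sum fun w q => (q : ℝ) * zetaNatW N w

/-- A word lies in `𝔥¹ = ℚ + e₁ℚ⟨e₀,e₁⟩`: empty, or starting with `e₁`. -/
def WordH1 (w : List Bool) : Prop := w ≠ [] → w.head? = some true

/-- A word lies in `𝔥⁰ = ℚ + e₁ℚ⟨e₀,e₁⟩e₀`: empty, or starting with `e₁`
and ending with `e₀`. -/
def WordH0 (w : List Bool) : Prop :=
  WordH1 w ∧ (w ≠ [] → w.getLast? = some false)

/-- Truncated sums, recursion on the reversed word. -/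
noncomputable def zR (N : ℕ) : List Bool → ℕ → ℝ
  | [], _ => 1
  | a :: w, M => ∑ n ∈ Finset.Ico 1 M, omegaHat N a n * zR N w n

noncomputable def gSum (N k : ℕ) (u : Fin k → Bool) (M : ℕ) : ℝ :=
  ∑ n ∈ (Fintype.piFinset (fun _ : Fin k => Finset.Ico 1 M)).filter (fun n => StrictMono n),
    ∏ i, omegaHat N (u i) (n i)

lemma strictMono_snoc_iff {k : ℕ} (m : Fin k → ℕ) (x : ℕ) :
    StrictMono (Fin.snoc m x : Fin (k+1) → ℕ) ↔ StrictMono m ∧ ∀ i, m i < x := by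
  constructor
  · intro h
    refine ⟨fun i j hij => ?_, fun i => ?_⟩
    · have := h (show i.castSucc < j.castSucc from hij)
      simpa using this
    · have := h (Fin.castSucc_lt_last i)
      simpa using this
  · rintro ⟨h1, h2⟩ i j hij
    induction j using Fin.lastCases with
    | last =>
      induction i using Fin.lastCases with
      | last => exact absurd hij (lt_irrefl _)
      | cast i => simpa using h2 i
    | cast j =>
      induction i using Fin.lastCases with
      | last => exact absurd hij (not_lt.mpr (Fin.le_last _))
      | cast i =>
        simp only [Fin.snoc_castSucc]
        exact h1 hij

lemma gSum_succ (N k : ℕ) (u : Fin (k+1) → Bool) (M : ℕ) :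
    gSum N (k+1) u M = ∑ x ∈ Finset.Ico 1 M,
      omegaHat N (u (Fin.last k)) x * gSum N k (fun i => u i.castSucc) x := by
  unfold gSum
  simp_rw [Finset.mul_sum]
  rw [Finset.sum_sigma']
  refine Finset.sum_bij' (fun n _ => ⟨n (Fin.last k), fun i => n i.castSucc⟩)
    (fun p _ => (Fin.snoc p.2 p.1 : Fin (k+1) → ℕ)) ?_ ?_ ?_ ?_ ?_
  · intro n hn
    simp only [Finset.mem_filter, Fintype.mem_piFinset, Finset.mem_sigma, Finset.mem_Ico] at hn ⊢
    refine ⟨hn.1 _, fun i => ⟨(hn.1 _).1, hn.2 (Fin.castSucc_lt_last i)⟩, fun i j hij => hn.2 ?_⟩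
    exact hij
  · rintro ⟨x, m⟩ hp
    simp only [Finset.mem_filter, Fintype.mem_piFinset, Finset.mem_sigma, Finset.mem_Ico] at hp ⊢
    refine ⟨fun i => ?_, (strictMono_snoc_iff m x).2 ⟨hp.2.2, fun i => (hp.2.1 i).2⟩⟩
    induction i using Fin.lastCases with
    | last => simpa using hp.1
    | cast i =>
      have := hp.2.1 i
      simp only [Fin.snoc_castSucc]
      omega
  · intro n hn
    funext i
    induction i using Fin.lastCases with
    | last => simp
    | cast i => simp
  · rintro ⟨x, m⟩ hp
    simp
  · intro n hn
    rw [Fin.prod_univ_castSucc, mul_comm]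

lemma gSum_eq (N k : ℕ) : ∀ (u : Fin k → Bool) (M : ℕ),
    gSum N k u M = zR N (List.ofFn u).reverse M := by
  induction k with
  | zero =>
    intro u M
    simp [gSum, zR, Finset.filter_true_of_mem, Subsingleton.strictMono]
  | succ k ih =>
    intro u M
    rw [gSum_succ, List.ofFn_succ', List.concat_eq_append, List.reverse_append]
    simp only [List.reverse_cons, List.reverse_nil, List.nil_append, List.cons_append, zR]
    exact Finset.sum_congr rfl fun x _ => by rw [ih]

lemma zetaNatW_eq (N : ℕ) (u : List Bool) : zetaNatW N u = zR N u.reverse N := by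
  have h : zetaNatW N u = gSum N u.length u.get N := by
    unfold zetaNatW gSum
    refine Finset.sum_bij (fun n _ => fun i => (n i : ℕ)) ?_ ?_ ?_ ?_
    · intro n hn
      simp only [Finset.mem_filter, Finset.mem_univ, true_and, Fintype.mem_piFinset,
        Finset.mem_Ico] at hn ⊢
      exact ⟨fun i => ⟨hn.1 i, (n i).2⟩, fun i j hij => hn.2 hij⟩
    · intro n _ m _ h
      funext i
      exact Fin.ext (congrFun h i)
    · intro m hm
      simp only [Finset.mem_filter, Fintype.mem_piFinset, Finset.mem_Ico] at hm
      refine ⟨fun i => ⟨m i, (hm.1 i).2⟩, ?_, rfl⟩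
      simp only [Finset.mem_filter, Finset.mem_univ, true_and]
      exact ⟨fun i => (hm.1 i).1, fun i j hij => hm.2 hij⟩
    · intro n _
      rfl
  rw [h, gSum_eq, List.ofFn_get]

/-- linear extension of `zR` -/
noncomputable def zLin (N : ℕ) (f : List Bool →₀ ℚ) (M : ℕ) : ℝ :=
  f.sum fun w q => (q : ℝ) * zR N w M

lemma zLin_add (N : ℕ) (f g : List Bool →₀ ℚ) (M : ℕ) :
    zLin N (f + g) M = zLin N f M + zLin N g M := by
  unfold zLin
  rw [Finsupp.sum_add_index']
  · simp
  · intros; push_cast; ring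

lemma zLin_cons (N : ℕ) (a : Bool) (f : List Bool →₀ ℚ) (M : ℕ) :
    zLin N (f.mapDomain (List.cons a)) M =
      ∑ n ∈ Finset.Ico 1 M, omegaHat N a n * zLin N f n := by
  unfold zLin
  rw [Finsupp.sum_mapDomain_index (by simp) (by intros; push_cast; ring)]
  simp only [Finsupp.sum, zR, Finset.mul_sum]
  rw [Finset.sum_comm]
  refine Finset.sum_congr rfl fun x _ => Finset.sum_congr rfl fun y _ => by ring

noncomputable def errE (N : ℕ) (w w' : List Bool) (M : ℕ) : ℝ :=
  zR N w M * zR N w' M - zLin N (shR w w') M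

lemma errE_nil_left (N : ℕ) (w : List Bool) (M : ℕ) : errE N [] w M = 0 := by
  simp [errE, shR, zLin, zR]

lemma errE_nil_right (N : ℕ) (w : List Bool) (M : ℕ) : errE N w [] M = 0 := by
  cases w <;> simp [errE, shR, zLin, zR]

lemma prod_sum_Ico (f g : ℕ → ℝ) (M : ℕ) :
    (∑ n ∈ Finset.Ico 1 M, f n) * (∑ n ∈ Finset.Ico 1 M, g n) =
      ∑ n ∈ Finset.Ico 1 M, f n * (∑ m ∈ Finset.Ico 1 n, g m)
      + ∑ n ∈ Finset.Ico 1 M, g n * (∑ m ∈ Finset.Ico 1 n, f m)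
      + ∑ n ∈ Finset.Ico 1 M, f n * g n := by
  induction M with
  | zero => simp
  | succ M ih =>
    rcases Nat.eq_zero_or_pos M with rfl | h
    · simp
    · simp only [Finset.sum_Ico_succ_top h]
      linear_combination ih

lemma errE_cons (N : ℕ) (a b : Bool) (w w' : List Bool) (M : ℕ) :
    errE N (a :: w) (b :: w') M =
      ∑ n ∈ Finset.Ico 1 M, omegaHat N a n * errE N w (b :: w') n
      + ∑ n ∈ Finset.Ico 1 M, omegaHat N b n * errE N (a :: w) w' n
      + ∑ n ∈ Finset.Ico 1 M, omegaHat N a n * omegaHat N b n * (zR N w n * zR N w' n) := by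
  have h1 : shR (a :: w) (b :: w') = (shR w (b :: w')).mapDomain (List.cons a)
    + (shR (a :: w) w').mapDomain (List.cons b) := by rw [shR]
  have h2 := prod_sum_Ico (fun n => omegaHat N a n * zR N w n)
    (fun n => omegaHat N b n * zR N w' n) M
  have e1 : ∀ M, ∑ n ∈ Finset.Ico 1 M, omegaHat N a n * zR N w n = zR N (a :: w) M :=
    fun M => rfl
  have e2 : ∀ M, ∑ n ∈ Finset.Ico 1 M, omegaHat N b n * zR N w' n = zR N (b :: w') M :=
    fun M => rfl
  simp only [e1, e2] at h2
  unfold errE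
  rw [h1, zLin_add, zLin_cons, zLin_cons, h2]
  simp only [mul_sub, Finset.sum_sub_distrib]
  have e3 : ∀ n, omegaHat N a n * zR N w n * zR N (b :: w') n
    = omegaHat N a n * (zR N w n * zR N (b :: w') n) := fun n => by ring
  have e4 : ∀ n, omegaHat N b n * zR N w' n * zR N (a :: w) n
    = omegaHat N b n * (zR N (a :: w) n * zR N w' n) := fun n => by ring
  have e5 : ∀ n, omegaHat N a n * zR N w n * (omegaHat N b n * zR N w' n)
    = omegaHat N a n * omegaHat N b n * (zR N w n * zR N w' n) := fun n => by ring
  simp only [e3, e4, e5]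
  ring

/-! ### Estimates -/

lemma omegaHat_nonneg {N n : ℕ} (h : n < N) (a : Bool) : 0 ≤ omegaHat N a n := by
  have : (n : ℝ) < N := by exact_mod_cast h
  unfold omegaHat
  split_ifs
  · exact div_nonneg zero_le_one (by linarith)
  · positivity

noncomputable def LL (N : ℕ) : ℝ := 1 + ∑ n ∈ Finset.Ico 1 N, 1 / (n : ℝ)

lemma one_le_LL (N : ℕ) : 1 ≤ LL N := by
  unfold LL
  have : 0 ≤ ∑ n ∈ Finset.Ico 1 N, 1 / (n : ℝ) := Finset.sum_nonneg fun _ _ => by positivity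
  linarith

lemma sum_omega_le {N M : ℕ} (h : M ≤ N) (a : Bool) :
    ∑ n ∈ Finset.Ico 1 M, omegaHat N a n ≤ LL N := by
  have h1 : ∑ n ∈ Finset.Ico 1 M, omegaHat N a n ≤ ∑ n ∈ Finset.Ico 1 N, omegaHat N a n := by
    refine Finset.sum_le_sum_of_subset_of_nonneg (Finset.Ico_subset_Ico_right h) ?_
    intro i hi _
    exact omegaHat_nonneg (Finset.mem_Ico.1 hi).2 a
  have h2 : ∑ n ∈ Finset.Ico 1 N, omegaHat N a n = ∑ n ∈ Finset.Ico 1 N, 1 / (n : ℝ) := by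
    cases a
    · simp [omegaHat]
    · refine Finset.sum_bij' (fun n _ => N - n) (fun n _ => N - n) ?_ ?_ ?_ ?_ ?_
      · intro n hn; simp only [Finset.mem_Ico] at *; omega
      · intro n hn; simp only [Finset.mem_Ico] at *; omega
      · intro n hn; simp only [Finset.mem_Ico] at *; omega
      · intro n hn; simp only [Finset.mem_Ico] at *; omega
      · intro n hn
        have := (Finset.mem_Ico.1 hn).2
        simp [omegaHat, Nat.cast_sub this.le]
  unfold LL
  linarith

lemma sum_omega_mul_le {N M : ℕ} (h : M ≤ N) (a : Bool) (f : ℕ → ℝ) (B : ℝ) (hB : 0 ≤ B)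
    (hf : ∀ n, 1 ≤ n → n < M → f n ≤ B) :
    ∑ n ∈ Finset.Ico 1 M, omegaHat N a n * f n ≤ LL N * B := by
  calc _ ≤ ∑ n ∈ Finset.Ico 1 M, omegaHat N a n * B := by
        refine Finset.sum_le_sum fun n hn => ?_
        obtain ⟨h1, h2⟩ := Finset.mem_Ico.1 hn
        exact mul_le_mul_of_nonneg_left (hf n h1 h2) (omegaHat_nonneg (h2.trans_le h) a)
    _ = (∑ n ∈ Finset.Ico 1 M, omegaHat N a n) * B := by rw [Finset.sum_mul]
    _ ≤ _ := mul_le_mul_of_nonneg_right (sum_omega_le h a) hB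

lemma zR_nonneg (N : ℕ) (w : List Bool) : ∀ M, M ≤ N → 0 ≤ zR N w M := by
  induction w with
  | nil => intro M _; simp [zR]
  | cons a w ih =>
    intro M hM
    refine Finset.sum_nonneg fun n hn => ?_
    have := (Finset.mem_Ico.1 hn).2
    exact mul_nonneg (omegaHat_nonneg (by omega) a) (ih n (by omega))

lemma zR_le (N : ℕ) (w : List Bool) : ∀ M, M ≤ N → zR N w M ≤ LL N ^ w.length := by
  induction w with
  | nil => intro M _; simp [zR]
  | cons a w ih =>
    intro M hM
    have := one_le_LL N
    rw [List.length_cons, pow_succ']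
    exact sum_omega_mul_le hM a _ _ (by positivity) fun n _ h => ih n (by omega)

/-- Reversed words of `𝔥¹`. -/
def Good (w : List Bool) : Prop := w ≠ [] → w.getLast? = some true

lemma Good.tail {a : Bool} {w : List Bool} (h : Good (a :: w)) : Good w := by
  intro hw
  have := h (by simp)
  rwa [List.getLast?_cons_of_ne_nil hw] at this

lemma Good.ne_nil {w : List Bool} (h : Good (false :: w)) : w ≠ [] := by
  rintro rfl
  have := h (by simp)
  simp at this

lemma zR_le_good (N : ℕ) (w : List Bool) : w ≠ [] → Good w → ∀ M, M ≤ N →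
    zR N w M ≤ LL N ^ w.length * (M / ((N : ℝ) - M + 1)) := by
  induction w with
  | nil => intro h; exact absurd rfl h
  | cons a w ih =>
    intro _ hg M hM
    have hL := one_le_LL N
    have hMN : (M : ℝ) ≤ N := by exact_mod_cast hM
    have hpos : (0 : ℝ) < (N : ℝ) - M + 1 := by linarith
    by_cases hw : w = []
    · subst hw
      have ha : a = true := by
        have := hg (by simp)
        simpa using this
      subst ha
      have h1 : zR N [true] M ≤ ∑ n ∈ Finset.Ico 1 M, 1 / ((N : ℝ) - M + 1) := by
        refine Finset.sum_le_sum fun n hn => ?_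
        have h2 := (Finset.mem_Ico.1 hn).2
        have h3 : (n : ℝ) + 1 ≤ M := by exact_mod_cast h2
        simp only [zR, omegaHat, if_true, mul_one]
        exact one_div_le_one_div_of_le hpos (by linarith)
      have h2 : ∑ n ∈ Finset.Ico 1 M, 1 / ((N : ℝ) - M + 1) ≤ M / ((N : ℝ) - M + 1) := by
        rw [Finset.sum_const, Nat.card_Ico, nsmul_eq_mul, mul_one_div]
        have : ((M - 1 : ℕ) : ℝ) ≤ M := by exact_mod_cast Nat.sub_le _ _
        gcongr
      have h3 : (M : ℝ) / ((N : ℝ) - M + 1) ≤ LL N ^ 1 * (M / ((N : ℝ) - M + 1)) := by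
        rw [pow_one]
        exact le_mul_of_one_le_left (by positivity) hL
      exact h1.trans (h2.trans h3)
    · rw [List.length_cons, pow_succ', mul_assoc]
      refine sum_omega_mul_le hM a _ _ (by positivity) fun n _ h => ?_
      refine (ih hw hg.tail n (by omega)).trans ?_
      have : (n : ℝ) ≤ M := by exact_mod_cast h.le
      gcongr

lemma errE_nonneg (N : ℕ) : ∀ (w w' : List Bool) (M : ℕ), M ≤ N → 0 ≤ errE N w w' M
  | [], w', M, _ => by rw [errE_nil_left]
  | a :: w, [], M, _ => by rw [errE_nil_right]
  | a :: w, b :: w', M, hM => by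
    rw [errE_cons]
    refine add_nonneg (add_nonneg ?_ ?_) ?_ <;> refine Finset.sum_nonneg fun n hn => ?_ <;>
      have h2 : n < N := (Finset.mem_Ico.1 hn).2.trans_le hM
    · exact mul_nonneg (omegaHat_nonneg h2 _) (errE_nonneg N w (b :: w') n h2.le)
    · exact mul_nonneg (omegaHat_nonneg h2 _) (errE_nonneg N (a :: w) w' n h2.le)
    · exact mul_nonneg (mul_nonneg (omegaHat_nonneg h2 _) (omegaHat_nonneg h2 _))
        (mul_nonneg (zR_nonneg N w n h2.le) (zR_nonneg N w' n h2.le))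
termination_by w w' => w.length + w'.length

lemma zz_le {N n : ℕ} (w w' : List Bool) (h : n ≤ N) :
    zR N w n * zR N w' n ≤ LL N ^ (w.length + w'.length) := by
  rw [pow_add]
  have := one_le_LL N
  exact mul_le_mul (zR_le N w n h) (zR_le N w' n h) (zR_nonneg N w' n h) (by positivity)

lemma zz_le_good {N n : ℕ} (w w' : List Bool) (hn : w ≠ []) (hg : Good w) (h : n ≤ N) :
    zR N w n * zR N w' n ≤ LL N ^ (w.length + w'.length) * (n / ((N : ℝ) - n + 1)) := by
  have := one_le_LL N
  have hMN : (n : ℝ) ≤ N := by exact_mod_cast h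
  have hpos : (0 : ℝ) < (N : ℝ) - n + 1 := by linarith
  calc _ ≤ (LL N ^ w.length * (n / ((N : ℝ) - n + 1))) * LL N ^ w'.length :=
        mul_le_mul (zR_le_good N w hn hg n h) (zR_le N w' n h) (zR_nonneg N w' n h)
          (by positivity)
    _ = _ := by rw [pow_add]; ring

/-- diagonal term, pointwise -/
lemma diag_true {N M n : ℕ} (hM : M ≤ N) (hn : n < M) :
    omegaHat N true n ≤ 1 / ((N : ℝ) - M + 1) := by
  have hMN : (M : ℝ) ≤ N := by exact_mod_cast hM
  have h3 : (n : ℝ) + 1 ≤ M := by exact_mod_cast hn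
  simp only [omegaHat, if_true]
  exact one_div_le_one_div_of_le (by linarith) (by linarith)

lemma diag_ff {N n : ℕ} (w w' : List Bool) (hg : Good (false :: w)) (h1 : 1 ≤ n) (h : n ≤ N) :
    omegaHat N false n * (zR N w n * zR N w' n) ≤
      LL N ^ (w.length + w'.length) * (1 / ((N : ℝ) - n + 1)) := by
  have h4 : (1 : ℝ) ≤ n := by exact_mod_cast h1
  have := zz_le_good w w' hg.ne_nil hg.tail h
  calc _ ≤ omegaHat N false n * (LL N ^ (w.length + w'.length) * (n / ((N : ℝ) - n + 1))) := by
        refine mul_le_mul_of_nonneg_left this ?_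
        simp [omegaHat]
    _ = _ := by
        simp only [omegaHat]
        have : (n : ℝ) ≠ 0 := by positivity
        simp
        field_simp

lemma diagA {N M : ℕ} (hM : M ≤ N) (a b : Bool) (w w' : List Bool) (hg : Good (a :: w)) :
    ∑ n ∈ Finset.Ico 1 M, omegaHat N a n * omegaHat N b n * (zR N w n * zR N w' n) ≤
      LL N ^ (w.length + w'.length + 1) * (1 / ((N : ℝ) - M + 1)) := by
  have hL := one_le_LL N
  have hMN : (M : ℝ) ≤ N := by exact_mod_cast hM
  have hpos : (0 : ℝ) < (N : ℝ) - M + 1 := by linarith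
  have hP : 0 ≤ LL N ^ (w.length + w'.length) * (1 / ((N : ℝ) - M + 1)) := by positivity
  have tt : ∀ n, 1 ≤ n → n < M → omegaHat N true n * (zR N w n * zR N w' n) ≤
      LL N ^ (w.length + w'.length) * (1 / ((N : ℝ) - M + 1)) := by
    intro n h1 h2
    rw [mul_comm]
    exact mul_le_mul (zz_le w w' (by omega)) (diag_true hM h2)
      (omegaHat_nonneg (by omega) _) (by positivity)
  rw [pow_succ', mul_assoc]
  cases a
  · cases b
    · simp only [mul_assoc (omegaHat N false _)]
      refine sum_omega_mul_le hM false _ _ hP fun n h1 h2 => ?_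
      refine (diag_ff w w' hg h1 (by omega)).trans ?_
      have : (n : ℝ) ≤ M := by exact_mod_cast h2.le
      gcongr
    · simp only [mul_assoc (omegaHat N false _)]
      exact sum_omega_mul_le hM false _ _ hP tt
  · have e : ∀ n, omegaHat N true n * omegaHat N b n * (zR N w n * zR N w' n)
      = omegaHat N b n * (omegaHat N true n * (zR N w n * zR N w' n)) := fun n => by ring
    simp only [e]
    exact sum_omega_mul_le hM b _ _ hP tt

lemma errE_le_A (N : ℕ) : ∀ (w w' : List Bool) (M : ℕ), Good w → Good w' → M ≤ N →
    errE N w w' M ≤ (3 * LL N) ^ (w.length + w'.length) * (1 / ((N : ℝ) - M + 1))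
  | [], w', M, _, _, hM => by
    have hMN : (M : ℝ) ≤ N := by exact_mod_cast hM
    have hpos : (0 : ℝ) < (N : ℝ) - M + 1 := by linarith
    have hL := one_le_LL N
    rw [errE_nil_left]; positivity
  | a :: w, [], M, _, _, hM => by
    have hMN : (M : ℝ) ≤ N := by exact_mod_cast hM
    have hpos : (0 : ℝ) < (N : ℝ) - M + 1 := by linarith
    have hL := one_le_LL N
    rw [errE_nil_right]; positivity
  | a :: w, b :: w', M, hg, hg', hM => by
    have hMN : (M : ℝ) ≤ N := by exact_mod_cast hM
    have hpos : (0 : ℝ) < (N : ℝ) - M + 1 := by linarith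
    have hL := one_le_LL N
    have hP : 0 ≤ (3 * LL N) ^ (w.length + w'.length + 1) * (1 / ((N : ℝ) - M + 1)) := by
      positivity
    rw [errE_cons]
    have i1 := sum_omega_mul_le hM a (fun n => errE N w (b :: w') n) _ hP (by
      intro n h1 h2
      refine (errE_le_A N w (b :: w') n hg.tail hg' (by omega)).trans ?_
      have : (n : ℝ) ≤ M := by exact_mod_cast h2.le
      rw [List.length_cons, ← add_assoc]
      gcongr)
    have i2 := sum_omega_mul_le hM b (fun n => errE N (a :: w) w' n) _ hP (by
      intro n h1 h2
      refine (errE_le_A N (a :: w) w' n hg hg'.tail (by omega)).trans ?_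
      have : (n : ℝ) ≤ M := by exact_mod_cast h2.le
      rw [List.length_cons, add_right_comm]
      gcongr)
    have i3 := diagA hM a b w w' hg
    have i4 : LL N ^ (w.length + w'.length + 1) * (1 / ((N : ℝ) - M + 1)) ≤
        LL N * ((3 * LL N) ^ (w.length + w'.length + 1) * (1 / ((N : ℝ) - M + 1))) := by
      have : LL N ^ (w.length + w'.length + 1) ≤ (3 * LL N) ^ (w.length + w'.length + 1) := by
        gcongr; linarith
      refine le_trans ?_ (le_mul_of_one_le_left hP hL)
      gcongr
    have e : (3 * LL N) ^ ((a :: w).length + (b :: w').length) * (1 / ((N : ℝ) - M + 1))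
      = 3 * (LL N * ((3 * LL N) ^ (w.length + w'.length + 1) * (1 / ((N : ℝ) - M + 1)))) := by
      simp only [List.length_cons]
      ring
    rw [e]
    linarith
termination_by w w' => w.length + w'.length

lemma two_term {N M : ℕ} (hM : M ≤ N) :
    ∑ n ∈ Finset.Ico 1 M, omegaHat N false n * omegaHat N true n ≤ 2 * LL N / N := by
  have : ∀ n ∈ Finset.Ico 1 M, omegaHat N false n * omegaHat N true n
      = (omegaHat N false n + omegaHat N true n) / N := by
    intro n hn
    obtain ⟨h1, h2⟩ := Finset.mem_Ico.1 hn
    have a1 : (1 : ℝ) ≤ n := by exact_mod_cast h1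
    have a2 : (n : ℝ) < N := by exact_mod_cast h2.trans_le hM
    have a3 : (N : ℝ) - n ≠ 0 := by linarith
    have a4 : (n : ℝ) ≠ 0 := by linarith
    have a5 : (N : ℝ) ≠ 0 := by linarith
    simp only [omegaHat, if_true, Bool.false_eq_true, if_false]
    field_simp
    ring
  rw [Finset.sum_congr rfl this, ← Finset.sum_div, Finset.sum_add_distrib]
  have h1 := sum_omega_le hM false
  have h2 := sum_omega_le hM true
  have : (0 : ℝ) ≤ N := by positivity
  gcongr
  linarith

lemma two_term_mul {N M : ℕ} (hM : M ≤ N) (f : ℕ → ℝ) (B : ℝ) (hB : 0 ≤ B)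
    (hf : ∀ n, 1 ≤ n → n < M → f n ≤ B * (1 / ((N : ℝ) - n + 1))) :
    ∑ n ∈ Finset.Ico 1 M, omegaHat N false n * f n ≤ 2 * LL N / N * B := by
  calc _ ≤ ∑ n ∈ Finset.Ico 1 M, (omegaHat N false n * omegaHat N true n) * B := by
        refine Finset.sum_le_sum fun n hn => ?_
        obtain ⟨h1, h2⟩ := Finset.mem_Ico.1 hn
        rw [mul_assoc]
        refine mul_le_mul_of_nonneg_left ((hf n h1 h2).trans ?_)
          (omegaHat_nonneg (h2.trans_le hM) _)
        rw [mul_comm]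
        refine mul_le_mul_of_nonneg_right ?_ hB
        have a2 : (n : ℝ) < N := by exact_mod_cast h2.trans_le hM
        simp only [omegaHat, if_true]
        exact one_div_le_one_div_of_le (by linarith) (by linarith)
    _ = (∑ n ∈ Finset.Ico 1 M, omegaHat N false n * omegaHat N true n) * B := by
        rw [Finset.sum_mul]
    _ ≤ _ := mul_le_mul_of_nonneg_right (two_term hM) hB

lemma diagB {N M : ℕ} (hM : M ≤ N) (a : Bool) (w w' : List Bool) (hg : Good (a :: w)) :
    ∑ n ∈ Finset.Ico 1 M, omegaHat N a n * omegaHat N false n * (zR N w n * zR N w' n) ≤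
      2 * LL N / N * LL N ^ (w.length + w'.length) := by
  have hL := one_le_LL N
  cases a
  · simp only [mul_assoc (omegaHat N false _)]
    exact two_term_mul hM _ _ (by positivity) fun n h1 h2 => diag_ff w w' hg h1 (by omega)
  · calc _ ≤ ∑ n ∈ Finset.Ico 1 M, (omegaHat N false n * omegaHat N true n)
          * LL N ^ (w.length + w'.length) := by
          refine Finset.sum_le_sum fun n hn => ?_
          obtain ⟨h1, h2⟩ := Finset.mem_Ico.1 hn
          rw [mul_comm (omegaHat N true n)]
          exact mul_le_mul_of_nonneg_left (zz_le w w' (by omega))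
            (mul_nonneg (omegaHat_nonneg (by omega) _) (omegaHat_nonneg (by omega) _))
      _ = (∑ n ∈ Finset.Ico 1 M, omegaHat N false n * omegaHat N true n)
          * LL N ^ (w.length + w'.length) := by rw [Finset.sum_mul]
      _ ≤ _ := mul_le_mul_of_nonneg_right (two_term hM) (by positivity)

lemma errE_le_B (N : ℕ) (w' : List Bool) (hg' : Good (false :: w')) : ∀ (w : List Bool),
    Good w → ∀ M, M ≤ N →
    errE N w (false :: w') M ≤ (6 * LL N) ^ (w.length + w'.length + 1) / N := by
  have hL := one_le_LL N
  intro w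
  induction w with
  | nil => intro _ M _; rw [errE_nil_left]; positivity
  | cons a w ih =>
    intro hg M hM
    rw [errE_cons]
    have i1 := sum_omega_mul_le hM a (fun n => errE N w (false :: w') n) _
      (by positivity) (fun n _ h => ih hg.tail n (by omega))
    have i2 := two_term_mul hM (fun n => errE N (a :: w) w' n)
      ((3 * LL N) ^ ((a :: w).length + w'.length)) (by positivity)
      (fun n _ h => errE_le_A N (a :: w) w' n hg hg'.tail (by omega))
    have i3 := diagB hM a w w' hg
    rw [List.length_cons, Nat.add_right_comm w.length 1 w'.length] at i2 ⊢
    set s := w.length + w'.length with hs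
    have j2 : 2 * LL N / N * (3 * LL N) ^ (s + 1) ≤ 2 * (LL N * ((6 * LL N) ^ (s + 1) / N)) := by
      have : (3 * LL N) ^ (s + 1) ≤ (6 * LL N) ^ (s + 1) := by gcongr; norm_num
      calc _ ≤ 2 * LL N / N * (6 * LL N) ^ (s + 1) := by gcongr
        _ = _ := by ring
    have j3 : 2 * LL N / N * LL N ^ s ≤ 2 * (LL N * ((6 * LL N) ^ (s + 1) / N)) := by
      have : LL N ^ s ≤ (6 * LL N) ^ (s + 1) := by
        calc LL N ^ s ≤ (6 * LL N) ^ s := by gcongr; linarith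
          _ ≤ _ := pow_le_pow_right₀ (by linarith) (by omega)
      calc _ ≤ 2 * LL N / N * (6 * LL N) ^ (s + 1) := by gcongr
        _ = _ := by ring
    have e : (6 * LL N) ^ (s + 1 + 1) / N = 6 * (LL N * ((6 * LL N) ^ (s + 1) / N)) := by ring
    have : 0 ≤ LL N * ((6 * LL N) ^ (s + 1) / N) := by positivity
    rw [e]
    linarith

lemma LL_le {N : ℕ} (hN : 2 ≤ N) : LL N ≤ (2 / Real.log 2 + 1) * Real.log N := by
  have h2 : 0 < Real.log 2 := Real.log_pos (by norm_num)
  have h3 : Real.log 2 ≤ Real.log N := Real.log_le_log (by norm_num) (by exact_mod_cast hN)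
  have h4 : ∑ n ∈ Finset.Ico 1 N, 1 / (n : ℝ) ≤ 1 + Real.log N := by
    have h := harmonic_le_one_add_log N
    rw [harmonic_eq_sum_Icc] at h
    push_cast at h
    refine le_trans ?_ h
    simp only [one_div]
    refine Finset.sum_le_sum_of_subset_of_nonneg ?_ (fun _ _ _ => by positivity)
    intro x hx
    simp only [Finset.mem_Ico, Finset.mem_Icc] at *
    omega
  have h5 : 2 ≤ 2 / Real.log 2 * Real.log N := by
    rw [div_mul_eq_mul_div, le_div_iff₀ h2]
    linarith
  unfold LL
  linarith

/-! ### Linear algebra -/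

lemma ZNnat_add (N : ℕ) (f g : List Bool →₀ ℚ) : ZNnat N (f + g) = ZNnat N f + ZNnat N g := by
  unfold ZNnat
  rw [Finsupp.sum_add_index']
  · simp
  · intros; push_cast; ring

lemma ZNnat_smul (N : ℕ) (c : ℚ) (f : List Bool →₀ ℚ) :
    ZNnat N (c • f) = (c : ℝ) * ZNnat N f := by
  unfold ZNnat
  rw [Finsupp.sum_smul_index (by simp), Finsupp.mul_sum]
  simp only [Finsupp.sum]
  exact Finset.sum_congr rfl fun _ _ => by push_cast; ring

lemma ZNnat_sum (N : ℕ) {ι : Type} (s : Finset ι) (F : ι → List Bool →₀ ℚ) :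
    ZNnat N (∑ i ∈ s, F i) = ∑ i ∈ s, ZNnat N (F i) := by
  induction s using Finset.induction_on with
  | empty => simp [ZNnat]
  | insert a s ha ih => rw [Finset.sum_insert ha, Finset.sum_insert ha, ZNnat_add, ih]

lemma ZNnat_shW (N : ℕ) (w w' : List Bool) :
    ZNnat N (shW w w') = zLin N (shR w.reverse w'.reverse) N := by
  unfold ZNnat shW zLin
  rw [Finsupp.sum_mapDomain_index (by simp) (by intros; push_cast; ring)]
  simp only [zetaNatW_eq, List.reverse_reverse]

lemma main_identity (N : ℕ) (f g : List Bool →₀ ℚ) :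
    ZNnat N f * ZNnat N g - ZNnat N (shLin f g) =
      ∑ w ∈ f.support, ∑ w' ∈ g.support,
        ((f w : ℝ) * (g w' : ℝ)) * errE N w.reverse w'.reverse N := by
  have h1 : ZNnat N (shLin f g) = ∑ w ∈ f.support, ∑ w' ∈ g.support,
      ((f w : ℝ) * (g w' : ℝ)) * zLin N (shR w.reverse w'.reverse) N := by
    unfold shLin
    simp only [Finsupp.sum, ZNnat_sum, ZNnat_smul, ZNnat_shW]
    push_cast
    rfl
  have h2 : ZNnat N f * ZNnat N g = ∑ w ∈ f.support, ∑ w' ∈ g.support,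
      ((f w : ℝ) * (g w' : ℝ)) * (zR N w.reverse N * zR N w'.reverse N) := by
    unfold ZNnat
    simp only [Finsupp.sum, zetaNatW_eq]
    rw [Finset.sum_mul_sum]
    exact Finset.sum_congr rfl fun _ _ => Finset.sum_congr rfl fun _ _ => by ring
  rw [h1, h2, ← Finset.sum_sub_distrib]
  refine Finset.sum_congr rfl fun _ _ => ?_
  rw [← Finset.sum_sub_distrib]
  refine Finset.sum_congr rfl fun _ _ => ?_
  unfold errE
  ring

lemma good_reverse {w : List Bool} (h : WordH1 w) : Good w.reverse := by
  intro hw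
  rw [List.getLast?_reverse]
  exact h (by simpa using hw)

lemma errE_bound (N : ℕ) (w w' : List Bool) (hw : WordH1 w) (hw' : WordH0 w') :
    errE N w.reverse w'.reverse N ≤ (6 * LL N) ^ (w.length + w'.length) / N := by
  have hL := one_le_LL N
  have hg' := good_reverse hw'.1
  by_cases h : w' = []
  · subst h
    rw [List.reverse_nil, errE_nil_right]
    positivity
  · have h2 := hw'.2 h
    rw [← List.head?_reverse] at h2
    rw [← List.length_reverse (as := w), ← List.length_reverse (as := w')]
    cases hr : w'.reverse with
    | nil => rw [hr] at h2; simp at h2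
    | cons b v =>
      rw [hr] at h2 hg'
      simp only [List.head?_cons, Option.some.injEq] at h2
      subst h2
      exact errE_le_B N v hg' _ (good_reverse hw) N le_rfl

/-- Asymptotic shuffle product formula: for `w₁ ∈ 𝔥¹`, `w₀ ∈ 𝔥⁰`,
`Z_N^♮(w₁)·Z_N^♮(w₀) = Z_N^♮(w₁ ⧢ w₀) + O(N⁻¹ logᵃ N)` as `N → ∞`, for some positive
integer `a`. -/
theorem stmt_8 (f g : List Bool →₀ ℚ)
    (hf : ∀ w ∈ f.support, WordH1 w) (hg : ∀ w ∈ g.support, WordH0 w) :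
    ∃ a : ℕ, 0 < a ∧ ∃ C : ℝ, ∀ N : ℕ, 2 ≤ N →
      |ZNnat N f * ZNnat N g - ZNnat N (shLin f g)| ≤ C * (Real.log N) ^ a / N := by
  set a : ℕ := f.support.sup List.length + g.support.sup List.length + 1 with ha
  set c : ℝ := 2 / Real.log 2 + 1 with hc
  refine ⟨a, by omega,
    ∑ w ∈ f.support, ∑ w' ∈ g.support, |(f w : ℝ) * (g w' : ℝ)| * (6 * c) ^ a, ?_⟩
  intro N hN
  have hL := one_le_LL N
  rw [main_identity, mul_div_assoc, Finset.sum_mul]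
  refine (Finset.abs_sum_le_sum_abs _ _).trans (Finset.sum_le_sum fun w hw => ?_)
  rw [Finset.sum_mul]
  refine (Finset.abs_sum_le_sum_abs _ _).trans (Finset.sum_le_sum fun w' hw' => ?_)
  rw [abs_mul, abs_of_nonneg (errE_nonneg N w.reverse w'.reverse N le_rfl), mul_assoc]
  refine mul_le_mul_of_nonneg_left ?_ (abs_nonneg _)
  refine (errE_bound N w w' (hf w hw) (hg w' hw')).trans ?_
  have h1 : w.length ≤ f.support.sup List.length := Finset.le_sup (f := List.length) hw
  have h2 : w'.length ≤ g.support.sup List.length := Finset.le_sup (f := List.length) hw'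
  have h3 : (6 * LL N) ^ (w.length + w'.length) ≤ (6 * LL N) ^ a :=
    pow_le_pow_right₀ (by linarith) (by omega)
  have h4 : (6 * LL N) ^ a ≤ (6 * c * Real.log N) ^ a := by
    refine pow_le_pow_left₀ (by linarith) ?_ a
    have := LL_le hN
    rw [mul_assoc]
    linarith
  rw [← mul_div_assoc, ← mul_pow]
  exact div_le_div_of_nonneg_right (h3.trans h4) (by positivity)
end

section
/- For indices 𝐤 of weight k and 𝐥 of weight l, the product of the strict sums decomposes as ζ^♮_{<N}(𝐤)·ζ^♮_{<N}(𝐥) = Σ_{σ∈Σ_{k,l}} Σ_{(r_1,...,r_{k+l})∈T_N(k+l)} Π_{h=1}^{k+l} ω̂_{u_h}^{(N)}(r_{σ(h)}) + D_N, where Σ_{k,l} is the set of (k,l)-shuffles and D_N is the sum over pairs of tuples sharing at least one common value; the first term equals Z_N^♮(e_𝐤 ⧢ e_𝐥). -/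
open Finset

open scoped Classical

/-- `Σ_{k,l}`: permutations of `[k+l]` strictly increasing on the first `k` and on the
last `l` positions. -/
noncomputable def shuffles (k l : ℕ) : Finset (Equiv.Perm (Fin (k + l))) :=
  Finset.univ.filter (fun σ =>
    (∀ i j : Fin (k + l), i.val < k → j.val < k → i < j → σ i < σ j) ∧
    (∀ i j : Fin (k + l), k ≤ i.val → k ≤ j.val → i < j → σ i < σ j))

/-- `Σ_{σ∈Σ_{k,l}} Σ_{(r₁,…,r_{k+l})∈T_N(k+l)} Π_h ω̂_{u_h}^{(N)}(r_{σ(h)})`. -/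
noncomputable def sigmaSum (N k l : ℕ) (u : List Bool) : ℝ :=
  ∑ σ ∈ shuffles k l,
    ∑ r ∈ Finset.univ.filter
        (fun r : Fin (k + l) → Fin N => (∀ i, 0 < (r i : ℕ)) ∧ StrictMono r),
      ∏ h, omegaHat N (u.getD h.val false) (r (σ h))

/-- The "diagonal" sum `D_N` over pairs of strictly increasing tuples sharing at least
one common value. -/
noncomputable def diagSum (N : ℕ) (K L : List ℕ) : ℝ :=
  ∑ p ∈ (Finset.univ : Finset ((Fin (wordOf K).length → Fin N) ×
        (Fin (wordOf L).length → Fin N))).filter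
      (fun p => ((∀ i, 0 < (p.1 i : ℕ)) ∧ StrictMono p.1) ∧
        ((∀ j, 0 < (p.2 j : ℕ)) ∧ StrictMono p.2) ∧
        ∃ i j, (p.1 i : ℕ) = (p.2 j : ℕ)),
    (∏ i, omegaHat N ((wordOf K).getD i.val false) (p.1 i)) *
      (∏ j, omegaHat N ((wordOf L).getD j.val false) (p.2 j))

namespace Aux9

/-- pairs of disjoint strictly increasing tuples in `(0,M)`. -/
noncomputable def T (M k l : ℕ) : Finset ((Fin k → ℕ) × (Fin l → ℕ)) :=
  ((Fintype.piFinset fun _ : Fin k => Finset.Ioo 0 M) ×ˢ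
    (Fintype.piFinset fun _ : Fin l => Finset.Ioo 0 M)).filter
    (fun p => StrictMono p.1 ∧ StrictMono p.2 ∧ ∀ i j, p.1 i ≠ p.2 j)

lemma mem_T {M k l : ℕ} {p : (Fin k → ℕ) × (Fin l → ℕ)} : p ∈ T M k l ↔
    ((∀ i, 0 < p.1 i ∧ p.1 i < M) ∧ (∀ j, 0 < p.2 j ∧ p.2 j < M)) ∧
    StrictMono p.1 ∧ StrictMono p.2 ∧ ∀ i j, p.1 i ≠ p.2 j := by
  simp [T]

noncomputable def wt (f : Bool → ℕ → ℝ) (U V : ℕ → Bool) {k l : ℕ}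
    (p : (Fin k → ℕ) × (Fin l → ℕ)) : ℝ :=
  (∏ i : Fin k, f (U i) (p.1 i)) * ∏ j : Fin l, f (V j) (p.2 j)

noncomputable def D (f : Bool → ℕ → ℝ) (M k l : ℕ) (U V : ℕ → Bool) : ℝ :=
  ∑ p ∈ T M k l, wt f U V p

lemma D_swap (f : Bool → ℕ → ℝ) (M k l : ℕ) (U V : ℕ → Bool) :
    D f M k l U V = D f M l k V U := by
  unfold D
  refine Finset.sum_bij' (fun p _ => p.swap) (fun p _ => p.swap) ?_ ?_ ?_ ?_ ?_
  · rintro ⟨p, q⟩ h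
    rw [mem_T] at h ⊢
    exact ⟨h.1.symm, h.2.2.1, h.2.1, fun i j e => h.2.2.2 j i e.symm⟩
  · rintro ⟨p, q⟩ h
    rw [mem_T] at h ⊢
    exact ⟨h.1.symm, h.2.2.1, h.2.1, fun i j e => h.2.2.2 j i e.symm⟩
  · intros; rfl
  · intros; rfl
  · rintro ⟨p, q⟩ h
    simp [wt, mul_comm]

lemma D_congr (f : Bool → ℕ → ℝ) (M k l : ℕ) {U V U' V' : ℕ → Bool}
    (hU : ∀ i < k, U i = U' i) (hV : ∀ i < l, V i = V' i) :
    D f M k l U V = D f M k l U' V' := by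
  unfold D wt
  refine Finset.sum_congr rfl fun p _ => ?_
  congr 1
  · exact Finset.prod_congr rfl fun i _ => by rw [hU i i.2]
  · exact Finset.prod_congr rfl fun i _ => by rw [hV i i.2]

lemma half (f : Bool → ℕ → ℝ) (M k l : ℕ) (U V : ℕ → Bool) :
    ∑ p ∈ (T M (k+1) l).filter (fun p => ∀ j, p.2 j < p.1 (Fin.last k)), wt f U V p =
      ∑ m ∈ Finset.Ioo 0 M, f (U k) m * D f m k l U V := by
  unfold D
  simp_rw [Finset.mul_sum]
  rw [Finset.sum_sigma']
  refine Finset.sum_bij'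
    (fun p _ => (⟨p.1 (Fin.last k), (Fin.init p.1, p.2)⟩ :
      (_ : ℕ) × ((Fin k → ℕ) × (Fin l → ℕ))))
    (fun s _ => (Fin.snoc (α := fun _ => ℕ) s.2.1 s.1, s.2.2)) ?_ ?_ ?_ ?_ ?_
  · rintro ⟨p, q⟩ h
    simp only [Finset.mem_filter, mem_T, Finset.mem_sigma, Finset.mem_Ioo] at h ⊢
    obtain ⟨⟨⟨h1, h2⟩, h3, h4, h5⟩, h6⟩ := h
    refine ⟨h1 _, ⟨fun i => ⟨(h1 _).1, h3 (Fin.castSucc_lt_last i)⟩,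
      fun j => ⟨(h2 j).1, h6 j⟩⟩, fun i j hij => h3 (by simpa using hij), h4,
      fun i j => h5 _ j⟩
  · rintro ⟨m, p, q⟩ h
    simp only [Finset.mem_filter, mem_T, Finset.mem_sigma, Finset.mem_Ioo] at h ⊢
    obtain ⟨⟨m0, mM⟩, ⟨h1, h2⟩, h3, h4, h5⟩ := h
    refine ⟨⟨⟨fun i => ?_, fun j => ⟨(h2 j).1, (h2 j).2.trans mM⟩⟩, ?_, h4, ?_⟩, ?_⟩
    · refine Fin.lastCases ?_ (fun i => ?_) i
      · simp [m0, mM]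
      · simpa using ⟨(h1 i).1, (h1 i).2.trans mM⟩
    · intro i j
      refine Fin.lastCases ?_ (fun i => ?_) i
      · intro h; exact absurd (Fin.le_last j) (not_le.2 h)
      · refine Fin.lastCases ?_ (fun j => ?_) j
        · intro _; simpa using (h1 i).2
        · intro h; simpa using h3 (by simpa using h)
    · intro i j
      refine Fin.lastCases ?_ (fun i => ?_) i
      · simpa using (h2 j).2.ne'
      · simpa using h5 i j
    · intro j; simpa using (h2 j).2
  · rintro ⟨p, q⟩ h
    simp
  · rintro ⟨m, p, q⟩ h
    simp
  · rintro ⟨p, q⟩ h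
    simp only [wt, Fin.prod_univ_castSucc, Fin.init, Fin.val_castSucc, Fin.val_last]
    ring

lemma D_zero (f : Bool → ℕ → ℝ) (M : ℕ) (U V : ℕ → Bool) : D f M 0 0 U V = 1 := by
  have : T M 0 0 = {default} := by
    ext p
    rw [mem_T]
    simp [Subsingleton.elim p default, Subsingleton.strictMono]
  simp [D, this, wt]

lemma D_succ_zero (f : Bool → ℕ → ℝ) (M k : ℕ) (U V : ℕ → Bool) :
    D f M (k+1) 0 U V = ∑ m ∈ Finset.Ioo 0 M, f (U k) m * D f m k 0 U V := by
  rw [← half, D]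
  congr 1
  ext p
  simp

lemma D_succ_succ (f : Bool → ℕ → ℝ) (M k l : ℕ) (U V : ℕ → Bool) :
    D f M (k+1) (l+1) U V = ∑ m ∈ Finset.Ioo 0 M, f (U k) m * D f m k (l+1) U V +
      ∑ m ∈ Finset.Ioo 0 M, f (V l) m * D f m (k+1) l U V := by
  have h2 : ∑ m ∈ Finset.Ioo 0 M, f (V l) m * D f m (k+1) l U V =
      ∑ m ∈ Finset.Ioo 0 M, f (V l) m * D f m l (k+1) V U :=
    Finset.sum_congr rfl fun m _ => by rw [D_swap]
  rw [h2, ← half, ← half, D, ← Finset.sum_filter_add_sum_filter_not (T M (k+1) (l+1))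
    (fun p => ∀ j, p.2 j < p.1 (Fin.last k))]
  congr 1
  refine Finset.sum_bij' (fun p _ => p.swap) (fun p _ => p.swap) ?_ ?_ ?_ ?_ ?_
  · rintro ⟨p, q⟩ h
    simp only [Finset.mem_filter, mem_T, Prod.fst_swap, Prod.snd_swap] at h ⊢
    obtain ⟨⟨h1, h3, h4, h5⟩, h6⟩ := h
    refine ⟨⟨h1.symm, h4, h3, fun i j e => h5 j i e.symm⟩, fun i => ?_⟩
    push Not at h6
    obtain ⟨j, hj⟩ := h6
    have a := h3.monotone (Fin.le_last i)
    have b := h4.monotone (Fin.le_last j)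
    have c := h5 i (Fin.last l)
    omega
  · rintro ⟨q, p⟩ h
    simp only [Finset.mem_filter, mem_T, Prod.fst_swap, Prod.snd_swap] at h ⊢
    obtain ⟨⟨h1, h3, h4, h5⟩, h6⟩ := h
    refine ⟨⟨h1.symm, h4, h3, fun i j e => h5 j i e.symm⟩, fun hh => ?_⟩
    exact absurd (hh (Fin.last l)) (not_lt.2 (h6 _).le)
  · intros; rfl
  · intros; rfl
  · rintro ⟨p, q⟩ h
    simp [wt, mul_comm]

/-- list version, words reversed -/
noncomputable def DL (f : Bool → ℕ → ℝ) (M : ℕ) (u v : List Bool) : ℝ :=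
  D f M u.length v.length (fun i => u.reverse.getD i false) (fun i => v.reverse.getD i false)

lemma getD_cons_lt (a : Bool) (u : List Bool) (i : ℕ) (hi : i < u.length) :
    (a :: u).reverse.getD i false = u.reverse.getD i false := by
  rw [List.reverse_cons, List.getD_append _ _ _ _ (by simpa using hi)]

lemma getD_cons_len (a : Bool) (u : List Bool) :
    (a :: u).reverse.getD u.length false = a := by
  rw [List.reverse_cons, List.getD_append_right _ _ _ _ (by simp)]
  simp

lemma DL_nil (f : Bool → ℕ → ℝ) (M : ℕ) : DL f M [] [] = 1 := D_zero _ _ _ _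

lemma DL_swap (f : Bool → ℕ → ℝ) (M : ℕ) (u v) : DL f M u v = DL f M v u := D_swap _ _ _ _ _ _

lemma DL_cons_nil (f : Bool → ℕ → ℝ) (M : ℕ) (a u) :
    DL f M (a :: u) [] = ∑ m ∈ Finset.Ioo 0 M, f a m * DL f m u [] := by
  unfold DL
  simp only [List.length_cons, List.length_nil]
  rw [D_succ_zero]
  refine Finset.sum_congr rfl fun m _ => ?_
  rw [getD_cons_len]
  congr 1
  exact D_congr _ _ _ _ (fun i hi => getD_cons_lt _ _ _ hi) (fun i hi => rfl)

lemma DL_cons_cons (f : Bool → ℕ → ℝ) (M : ℕ) (a u b v) :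
    DL f M (a :: u) (b :: v) = ∑ m ∈ Finset.Ioo 0 M, f a m * DL f m u (b :: v) +
      ∑ m ∈ Finset.Ioo 0 M, f b m * DL f m (a :: u) v := by
  unfold DL
  simp only [List.length_cons]
  rw [D_succ_succ]
  congr 1
  · refine Finset.sum_congr rfl fun m _ => ?_
    rw [getD_cons_len]
    congr 1
    exact D_congr _ _ _ _ (fun i hi => getD_cons_lt _ _ _ hi) (fun i hi => rfl)
  · refine Finset.sum_congr rfl fun m _ => ?_
    rw [getD_cons_len]
    congr 1
    exact D_congr _ _ _ _ (fun i hi => rfl) (fun i hi => getD_cons_lt _ _ _ hi)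

noncomputable def EV (f : Bool → ℕ → ℝ) (M : ℕ) (g : List Bool →₀ ℚ) : ℝ :=
  g.sum fun w q => (q : ℝ) * DL f M w []

lemma EV_add (f : Bool → ℕ → ℝ) (M : ℕ) (g h) : EV f M (g + h) = EV f M g + EV f M h := by
  unfold EV
  exact Finsupp.sum_add_index' (by simp) (by intros; push_cast; ring)

lemma EV_cons (f : Bool → ℕ → ℝ) (M : ℕ) (a g) :
    EV f M (g.mapDomain (List.cons a)) = ∑ m ∈ Finset.Ioo 0 M, f a m * EV f m g := by
  unfold EV
  rw [Finsupp.sum_mapDomain_index (by simp) (by intros; push_cast; ring)]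
  simp only [Finsupp.sum, DL_cons_nil, Finset.mul_sum]
  rw [Finset.sum_comm]
  refine Finset.sum_congr rfl fun m _ => Finset.sum_congr rfl fun w _ => by ring

lemma EV_single (f : Bool → ℕ → ℝ) (M : ℕ) (w) :
    EV f M (Finsupp.single w 1) = DL f M w [] := by
  unfold EV
  rw [Finsupp.sum_single_index] <;> simp

lemma EV_shR (f : Bool → ℕ → ℝ) (u v : List Bool) : ∀ M, EV f M (shR u v) = DL f M u v := by
  induction u generalizing v with
  | nil => intro M; rw [shR, EV_single, DL_swap]
  | cons a u ihu =>
    induction v with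
    | nil => intro M; rw [shR, EV_single]
    | cons b v ihv =>
      intro M
      rw [shR, EV_add, EV_cons, EV_cons, DL_cons_cons]
      simp only [ihu, ihv]

/-- `Fin N`-valued disjoint sums -/
noncomputable def DF (f : Bool → ℕ → ℝ) (N k l : ℕ) (U V : ℕ → Bool) : ℝ :=
  ∑ p ∈ (Finset.univ : Finset ((Fin k → Fin N) × (Fin l → Fin N))).filter
      (fun p => ((∀ i, 0 < (p.1 i : ℕ)) ∧ StrictMono p.1) ∧
        ((∀ j, 0 < (p.2 j : ℕ)) ∧ StrictMono p.2) ∧ ¬ ∃ i j, (p.1 i : ℕ) = (p.2 j : ℕ)),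
    (∏ i : Fin k, f (U i) (p.1 i)) * ∏ j : Fin l, f (V j) (p.2 j)

lemma DF_eq_D (f : Bool → ℕ → ℝ) (N k l : ℕ) (U V : ℕ → Bool) :
    DF f N k l U V = D f N k l U V := by
  unfold DF D
  refine Finset.sum_bij (fun p _ => (fun i => (p.1 i : ℕ), fun j => (p.2 j : ℕ))) ?_ ?_ ?_ ?_
  · rintro ⟨p, q⟩ h
    simp only [Finset.mem_filter, Finset.mem_univ, true_and, not_exists] at h
    rw [mem_T]
    exact ⟨⟨fun i => ⟨h.1.1 i, (p i).2⟩, fun i => ⟨h.2.1.1 i, (q i).2⟩⟩,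
      fun i j hij => h.1.2 hij, fun i j hij => h.2.1.2 hij, h.2.2⟩
  · rintro ⟨p, q⟩ _ ⟨p', q'⟩ _ h
    simp only [Prod.mk.injEq, funext_iff] at h
    ext i
    · exact h.1 i
    · exact h.2 i
  · rintro ⟨p, q⟩ h
    rw [mem_T] at h
    obtain ⟨⟨h1, h2⟩, h3, h4, h5⟩ := h
    refine ⟨(fun i => ⟨p i, (h1 i).2⟩, fun j => ⟨q j, (h2 j).2⟩), ?_, rfl⟩
    simp only [Finset.mem_filter, Finset.mem_univ, true_and, not_exists]
    exact ⟨⟨fun i => (h1 i).1, fun i j hij => h3 hij⟩,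
      ⟨fun i => (h2 i).1, fun i j hij => h4 hij⟩, h5⟩
  · intros; rfl

lemma zeta_mul (N : ℕ) (u v : List Bool) :
    zetaNatW N u * zetaNatW N v =
      DF (omegaHat N) N u.length v.length (fun i => u.getD i false) (fun i => v.getD i false) +
      ∑ p ∈ (Finset.univ : Finset ((Fin u.length → Fin N) × (Fin v.length → Fin N))).filter
      (fun p => ((∀ i, 0 < (p.1 i : ℕ)) ∧ StrictMono p.1) ∧
        ((∀ j, 0 < (p.2 j : ℕ)) ∧ StrictMono p.2) ∧
        ∃ i j, (p.1 i : ℕ) = (p.2 j : ℕ)),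
    (∏ i, omegaHat N (u.getD i.val false) (p.1 i)) *
      (∏ j, omegaHat N (v.getD j.val false) (p.2 j)) := by
  unfold zetaNatW DF
  rw [Finset.sum_mul_sum, ← Finset.sum_product',
    ← Finset.sum_filter_add_sum_filter_not _
      (fun p => ¬ ∃ i j, (p.1 i : ℕ) = (p.2 j : ℕ))]
  congr 1
  · refine Finset.sum_congr ?_ ?_
    · ext p
      simp only [Finset.mem_filter, Finset.mem_product, Finset.mem_univ, true_and, and_assoc]
    · intro p _; simp
  · refine Finset.sum_congr ?_ ?_
    · ext p
      simp only [Finset.mem_filter, Finset.mem_product, Finset.mem_univ, true_and, and_assoc,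
        not_not]
    · intro p _; simp

lemma zeta_nil (N : ℕ) : zetaNatW N [] = 1 := by
  unfold zetaNatW
  rw [Finset.filter_true_of_mem]
  · simp
  · intro n _
    exact ⟨fun i => i.elim0, fun i => i.elim0⟩

lemma zeta_eq (N : ℕ) (w : List Bool) :
    zetaNatW N w.reverse = DL (omegaHat N) N w [] := by
  have h := zeta_mul N w.reverse []
  rw [zeta_nil, mul_one] at h
  rw [h, Finset.filter_false_of_mem, DF_eq_D]
  · simp [DL]
  · rintro p _ ⟨_, _, _, j, _⟩
    exact j.elim0

lemma ZN_sh (N : ℕ) (u v : List Bool) :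
    ZNnat N (shW u v) =
      DF (omegaHat N) N u.length v.length (fun i => u.getD i false) (fun i => v.getD i false) := by
  unfold ZNnat shW
  rw [Finsupp.sum_mapDomain_index (by simp) (by intros; push_cast; ring)]
  simp only [zeta_eq]
  have := EV_shR (omegaHat N) u.reverse v.reverse N
  unfold EV at this
  rw [this, DF_eq_D]
  simp [DL]

lemma sigma_eq (N : ℕ) (u v : List Bool) :
    sigmaSum N u.length v.length (u ++ v) =
      DF (omegaHat N) N u.length v.length (fun i => u.getD i false) (fun i => v.getD i false) := by
  unfold sigmaSum DF
  rw [← Finset.sum_product']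
  refine Finset.sum_bij (fun s _ => (fun i => s.2 (s.1 (Fin.castAdd _ i)),
    fun j => s.2 (s.1 (Fin.natAdd _ j)))) ?_ ?_ ?_ ?_
  · rintro ⟨σ, r⟩ h
    simp only [shuffles, Finset.mem_filter, Finset.mem_product, Finset.mem_univ, true_and] at h ⊢
    obtain ⟨⟨h1, h2⟩, h3, h4⟩ := h
    refine ⟨⟨fun i => h3 _, fun i j hij => h4 (h1 _ _ (by simp) (by simp) hij)⟩,
      ⟨fun i => h3 _, fun i j hij => h4 (h2 _ _ (by simp) (by simp) (by simpa using hij))⟩, ?_⟩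
    rintro ⟨i, j, hij⟩
    have := congrArg Fin.val (σ.injective (h4.injective (Fin.ext hij)))
    simp at this
    omega
  · rintro ⟨σ, r⟩ h ⟨σ', r'⟩ h' e
    simp only [shuffles, Finset.mem_filter, Finset.mem_product, Finset.mem_univ, true_and] at h h'
    simp only [Prod.mk.injEq, funext_iff] at e
    have key : ∀ x, r (σ x) = r' (σ' x) := fun x => Fin.addCases e.1 e.2 x
    have hr : r = r' := by
      refine (StrictMono.range_inj h.2.2 h'.2.2).1 ?_
      rw [← σ.surjective.range_comp r, ← σ'.surjective.range_comp r']
      congr 1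
      exact funext key
    subst hr
    have : σ = σ' := Equiv.ext fun x => h.2.2.injective (key x)
    rw [this]
  · rintro ⟨p, q⟩ h
    simp only [Finset.mem_filter, Finset.mem_univ, true_and, not_exists] at h
    obtain ⟨⟨h1, h2⟩, ⟨h3, h4⟩, h5⟩ := h
    set n : Fin (u.length + v.length) → Fin N := Fin.append p q with hn
    have hl : ∀ i, n (Fin.castAdd _ i) = p i := fun i => by simp [hn]
    have hr : ∀ i, n (Fin.natAdd _ i) = q i := fun i => by simp [hn]
    have hinj : Function.Injective n := by
      intro x y
      refine Fin.addCases (fun i => ?_) (fun i => ?_) x <;>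
      refine Fin.addCases (fun j => ?_) (fun j => ?_) y
      · rw [hl, hl]; intro e; rw [h2.injective e]
      · rw [hl, hr]; intro e; exact absurd (congrArg Fin.val e) (h5 i j)
      · rw [hl, hr]; intro e; exact absurd (congrArg Fin.val e.symm) (h5 j i)
      · rw [hr, hr]; intro e; rw [h4.injective e]
    have hs : StrictMono (n ∘ Tuple.sort n) :=
      (Tuple.monotone_sort n).strictMono_of_injective (hinj.comp (Tuple.sort n).injective)
    have hlt : ∀ i j, n i < n j → (Tuple.sort n)⁻¹ i < (Tuple.sort n)⁻¹ j := by
      intro i j hij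
      rw [← hs.lt_iff_lt]
      simpa using hij
    have hpos : ∀ x, 0 < (n x : ℕ) := by
      intro x
      refine Fin.addCases (fun i => ?_) (fun i => ?_) x
      · rw [hl]; exact h1 i
      · rw [hr]; exact h3 i
    refine ⟨((Tuple.sort n)⁻¹, n ∘ Tuple.sort n), ?_, ?_⟩
    · simp only [shuffles, Finset.mem_filter, Finset.mem_product, Finset.mem_univ, true_and]
      refine ⟨⟨fun i j hi hj hij => hlt _ _ ?_, fun i j hi hj hij => hlt _ _ ?_⟩,
        fun i => hpos _, hs⟩
      · have := h2 (show (⟨i, hi⟩ : Fin u.length) < ⟨j, hj⟩ from hij)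
        rw [← hl, ← hl] at this
        exact this
      · revert hi hj hij
        refine Fin.addCases (fun i => ?_) (fun i => ?_) i <;>
        refine Fin.addCases (fun j => ?_) (fun j => ?_) j
        · intro hi; simp at hi; omega
        · intro hi; simp at hi; omega
        · intro _ hj; simp at hj; omega
        · intro _ _ hij; rw [hr, hr]; exact h4 (by simpa using hij)
    · simp [hl, hr]
  · rintro ⟨σ, r⟩ h
    rw [Fin.prod_univ_add]
    congr 1
    · refine Finset.prod_congr rfl fun i _ => ?_
      rw [Fin.val_castAdd, List.getD_append _ _ _ _ i.2]
    · refine Finset.prod_congr rfl fun i _ => ?_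
      rw [Fin.val_natAdd, List.getD_append_right _ _ _ _ (by simp), Nat.add_sub_cancel_left]

end Aux9

/-- for indices `𝐤` of weight `k` and `𝐥` of weight `l`,
`ζ^♮_{<N}(𝐤)·ζ^♮_{<N}(𝐥)` decomposes as the sum over `(k,l)`-shuffles plus the
diagonal sum `D_N`, and the shuffle term equals `Z_N^♮(e_𝐤 ⧢ e_𝐥)`. -/
theorem stmt_9 (K L : List ℕ) (hK : ∀ x ∈ K, 0 < x) (hL : ∀ x ∈ L, 0 < x) (N : ℕ) :
    zetaNatW N (wordOf K) * zetaNatW N (wordOf L) =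
      sigmaSum N (wordOf K).length (wordOf L).length (wordOf K ++ wordOf L)
        + diagSum N K L ∧
    sigmaSum N (wordOf K).length (wordOf L).length (wordOf K ++ wordOf L)
      = ZNnat N (shW (wordOf K) (wordOf L)) := by
  refine ⟨?_, ?_⟩
  · rw [Aux9.zeta_mul, Aux9.sigma_eq]
    rfl
  · rw [Aux9.sigma_eq, Aux9.ZN_sh]
end

section
/- (Extended double shuffle relation, harmonic regularization) For any w_1 ∈ 𝔥^1 and w_0 ∈ 𝔥^0, Z(reg_*(w_1 * w_0 − w_1 ⧢ w_0)) = 0, where Z : 𝔥^0 → ℝ is the multiple zeta value evaluation map and reg_* : 𝔥^1_* → 𝔥^0_* is the harmonic regularization (the constant term with respect to T under the isomorphism 𝔥^1_* ≅ 𝔥^0_*[T] sending e_1 to T). -/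
open Finset

open scoped Classical

/-- Auxiliary front-recursion for the harmonic (stuffle) product on reversed words. -/
noncomputable def stR : List ℕ → List ℕ → (List ℕ →₀ ℚ)
  | [], w => Finsupp.single w 1
  | a :: w, [] => Finsupp.single (a :: w) 1
  | a :: w, b :: w' =>
      (stR w (b :: w')).mapDomain (List.cons a)
    + (stR (a :: w) w').mapDomain (List.cons b)
    + (stR w w').mapDomain (List.cons (a + b))
termination_by w w' => w.length + w'.length
decreasing_by all_goals (simp; try omega)

/-- The harmonic product `e_𝐤 * e_𝐥` of two words of `𝔥¹`, encoded by their indices: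
it satisfies `w e_{k₁} * w' e_{k₂} = (w * w' e_{k₂}) e_{k₁} + (w e_{k₁} * w') e_{k₂}
+ (w * w') e_{k₁+k₂}` and `w * 1 = 1 * w = w`. -/
noncomputable def harmW (w w' : List ℕ) : List ℕ →₀ ℚ :=
  (stR w.reverse w'.reverse).mapDomain List.reverse

/-- ℚ-bilinear extension of the harmonic product to `𝔥¹`. -/
noncomputable def harmLin (f g : List ℕ →₀ ℚ) : List ℕ →₀ ℚ :=
  f.sum fun w q => g.sum fun w' q' => (q * q') • harmW w w'

open scoped Classical

/-- Decode a word of `𝔥¹` back into its index. -/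
def decode (w : List Bool) : List ℕ :=
  (w.foldr (fun b p => if b then (0, (p.1 + 1) :: p.2) else (p.1 + 1, p.2))
    ((0, []) : ℕ × List ℕ)).2

/-- The shuffle product on `𝔥¹`, expressed in the index encoding, extended ℚ-bilinearly. -/
noncomputable def shIdxLin (f g : List ℕ →₀ ℚ) : List ℕ →₀ ℚ :=
  f.sum fun w q => g.sum fun w' q' =>
    (q * q') • ((shW (wordOf w) (wordOf w')).mapDomain decode)

/-- The multiple harmonic sum `ζ_{<N}(𝐤)`. -/
noncomputable def MHS (N : ℕ) (k : List ℕ) : ℝ :=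
  ∑ n ∈ Finset.univ.filter
      (fun n : Fin k.length → Fin N => (∀ i, 0 < (n i : ℕ)) ∧ StrictMono n),
    ∏ i, (1 : ℝ) / (n i : ℕ) ^ k.get i

/-- `Z_N : 𝔥¹ → ℝ`, the ℚ-linear map with `Z_N(e_𝐤) = ζ_{<N}(𝐤)`, `Z_N(1) = 1`. -/
noncomputable def ZN (N : ℕ) (f : List ℕ →₀ ℚ) : ℝ :=
  f.sum fun k q => (q : ℝ) * MHS N k

/-- `f ∈ 𝔥¹`: every word in the support is an index (all entries positive). -/
def MemH1 (f : List ℕ →₀ ℚ) : Prop := ∀ w ∈ f.support, ∀ x ∈ w, 0 < x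

/-- `f ∈ 𝔥⁰`: every word in the support is an admissible index. -/
def MemH0 (f : List ℕ →₀ ℚ) : Prop :=
  ∀ w ∈ f.support, (∀ x ∈ w, 0 < x) ∧ ∀ x, w.getLast? = some x → 2 ≤ x

/-- The multiple zeta value `ζ(𝐤)` as an infinite sum over strictly increasing tuples. -/
noncomputable def zetaIdx (k : List ℕ) : ℝ :=
  ∑' n : {n : Fin k.length → ℕ // (∀ i, 0 < n i) ∧ StrictMono n},
    ∏ i, (1 : ℝ) / (n.1 i : ℝ) ^ k.get i

/-- `Z : 𝔥⁰ → ℝ`, the ℚ-linear MZV evaluation map. -/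
noncomputable def ZReal (f : List ℕ →₀ ℚ) : ℝ :=
  f.sum fun k q => (q : ℝ) * zetaIdx k


/-! ### Truncated sums, on reversed indices -/

noncomputable def eT (a n : ℕ) : ℝ := if n = 0 then 0 else ((n : ℝ) ^ a)⁻¹

lemma eT_nonneg (a n : ℕ) : 0 ≤ eT a n := by unfold eT; split_ifs <;> positivity

lemma eT_mul (a b n : ℕ) : eT a n * eT b n = eT (a + b) n := by
  unfold eT; split_ifs
  · simp
  · rw [pow_add, mul_inv]

lemma eT_anti {a b : ℕ} (h : a ≤ b) (n : ℕ) : eT b n ≤ eT a n := by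
  unfold eT; split_ifs with h0
  · exact le_rfl
  · have : (1 : ℝ) ≤ n := by exact_mod_cast Nat.one_le_iff_ne_zero.mpr h0
    gcongr

noncomputable def Mr : List ℕ → ℕ → ℝ
  | [], _ => 1
  | a :: w, N => ∑ n ∈ Finset.range N, Mr w n * eT a n

lemma Mr_succ (a : ℕ) (w : List ℕ) (N : ℕ) :
    Mr (a :: w) (N + 1) = Mr (a :: w) N + Mr w N * eT a N := by
  simp [Mr, Finset.sum_range_succ]

lemma Mr_nonneg (w : List ℕ) : ∀ N, 0 ≤ Mr w N := by
  induction w with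
  | nil => intro N; simp [Mr]
  | cons a w ih =>
    intro N
    exact Finset.sum_nonneg fun n _ => mul_nonneg (ih n) (eT_nonneg a n)

lemma Mr_mono (w : List ℕ) : Monotone (Mr w) := by
  cases w with
  | nil => intro a b _; simp [Mr]
  | cons a w =>
    refine monotone_nat_of_le_succ fun n => ?_
    rw [Mr_succ]
    exact le_add_of_nonneg_right (mul_nonneg (Mr_nonneg _ _) (eT_nonneg _ _))

noncomputable def hh (N : ℕ) : ℝ := Mr [1] N

lemma hh_eq (N : ℕ) : hh N = ∑ n ∈ Finset.range N, eT 1 n := by simp [hh, Mr]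

lemma hh_nonneg (N : ℕ) : 0 ≤ hh N := Mr_nonneg _ _

lemma hh_mono : Monotone hh := Mr_mono _

lemma Mr_le (w : List ℕ) (hw : ∀ x ∈ w, 0 < x) : ∀ N, Mr w N ≤ (1 + hh N) ^ w.length := by
  induction w with
  | nil => intro N; simp [Mr]
  | cons a w ih =>
    intro N
    have ih' := ih (fun x hx => hw x (by simp [hx]))
    have ha : 1 ≤ a := hw a (by simp)
    calc Mr (a :: w) N ≤ ∑ n ∈ Finset.range N, (1 + hh N) ^ w.length * eT 1 n := by
          refine Finset.sum_le_sum fun n hn => ?_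
          refine mul_le_mul ?_ (eT_anti ha n) (eT_nonneg _ _)
            (pow_nonneg (by linarith [hh_nonneg N]) _)
          exact (Mr_mono w (Finset.mem_range.mp hn).le).trans (ih' N)
      _ = (1 + hh N) ^ w.length * hh N := by rw [← Finset.mul_sum, hh_eq]
      _ ≤ _ := by
          rw [List.length_cons, pow_succ]
          have : 0 ≤ (1 + hh N) ^ w.length := pow_nonneg (by linarith [hh_nonneg N]) _
          nlinarith

/-- evaluation on reversed words -/
noncomputable def ER (N : ℕ) : (List ℕ →₀ ℚ) →ₗ[ℚ] ℝ :=
  Finsupp.linearCombination ℚ (fun w => Mr w N)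

/-- evaluation on words -/
noncomputable def EN (N : ℕ) : (List ℕ →₀ ℚ) →ₗ[ℚ] ℝ :=
  Finsupp.linearCombination ℚ (fun w => Mr w.reverse N)

lemma ER_cons_succ (a N : ℕ) (X : List ℕ →₀ ℚ) :
    ER (N + 1) (X.mapDomain (List.cons a)) =
      ER N (X.mapDomain (List.cons a)) + ER N X * eT a N := by
  unfold ER
  rw [Finsupp.linearCombination_mapDomain, Finsupp.linearCombination_mapDomain]
  simp only [Finsupp.linearCombination_apply, Finsupp.sum, Function.comp, Mr_succ,
    Finset.sum_mul, ← Finset.sum_add_distrib, smul_add, smul_mul_assoc]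

lemma ER_cons_zero (a : ℕ) (X : List ℕ →₀ ℚ) :
    ER 0 (X.mapDomain (List.cons a)) = 0 := by
  unfold ER
  rw [Finsupp.linearCombination_mapDomain]
  simp [Finsupp.linearCombination_apply, Finsupp.sum, Function.comp, Mr]

lemma ER_stR (u v : List ℕ) : ∀ N, ER N (stR u v) = Mr u N * Mr v N := by
  induction u, v using stR.induct with
  | case1 w => intro N; simp [stR, ER, Mr]
  | case2 a w => intro N; simp [stR, ER, Mr]
  | case3 a u b v ih1 ih2 ih3 =>
    intro N
    rw [stR, map_add, map_add]
    induction N with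
    | zero => simp only [ER_cons_zero]; simp [Mr]
    | succ N ihN =>
      rw [ER_cons_succ, ER_cons_succ, ER_cons_succ, ih1, ih2, ih3, Mr_succ, Mr_succ, ← eT_mul]
      linear_combination ihN

lemma EN_harmW (u v : List ℕ) (N : ℕ) :
    EN N (harmW u v) = Mr u.reverse N * Mr v.reverse N := by
  rw [← ER_stR, harmW, EN, Finsupp.linearCombination_mapDomain]
  simp [ER, Function.comp_def]

lemma EN_harmLin (f g : List ℕ →₀ ℚ) (N : ℕ) :
    EN N (harmLin f g) = EN N f * EN N g := by
  rw [harmLin, map_finsuppSum]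
  simp only [map_finsuppSum, map_smul, EN_harmW]
  simp only [EN, Finsupp.linearCombination_apply, Finsupp.sum, Finset.sum_mul_sum]
  refine Finset.sum_congr rfl fun a _ => Finset.sum_congr rfl fun b _ => ?_
  simp only [Rat.smul_def]; push_cast; ring

/-! ### Shuffle -/

open PowerSeries in
noncomputable def thP (F : PowerSeries ℝ) : PowerSeries ℝ :=
  PowerSeries.mk fun n => (n : ℝ) * PowerSeries.coeff n F

lemma thP_mul (F G : PowerSeries ℝ) : thP (F * G) = thP F * G + F * thP G := by
  ext n
  simp only [thP, PowerSeries.coeff_mk, PowerSeries.coeff_mul, map_add, Finset.mul_sum,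
    ← Finset.sum_add_distrib]
  refine Finset.sum_congr rfl fun p hp => ?_
  rw [← Finset.HasAntidiagonal.mem_antidiagonal.mp hp]; push_cast; ring

lemma thP_add (F G : PowerSeries ℝ) : thP (F + G) = thP F + thP G := by
  ext n; simp [thP, mul_add]

lemma thP_inj (F G : PowerSeries ℝ) (h : thP F = thP G)
    (h0 : PowerSeries.coeff 0 F = PowerSeries.coeff 0 G) : F = G := by
  ext n
  rcases Nat.eq_zero_or_pos n with rfl | hn
  · exact h0
  · have := congrArg (PowerSeries.coeff n) h
    simp only [thP, PowerSeries.coeff_mk] at this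
    have hn' : (n : ℝ) ≠ 0 := by positivity
    exact mul_left_cancel₀ hn' this

noncomputable def ker1 : Bool → PowerSeries ℝ
  | true => PowerSeries.mk fun n => if n = 0 then 0 else 1
  | false => 1

noncomputable def JP (a : Bool) : PowerSeries ℝ →ₗ[ℚ] PowerSeries ℝ where
  toFun F := PowerSeries.mk fun n => PowerSeries.coeff n (ker1 a * F) / n
  map_add' F G := by ext n; simp [mul_add, add_div]
  map_smul' q F := by
    ext n
    have : PowerSeries.coeff n (ker1 a * q • F) = q • PowerSeries.coeff n (ker1 a * F) := by
      rw [mul_smul_comm]; rfl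
    simp only [PowerSeries.coeff_mk, this]
    have h2 : PowerSeries.coeff n (q • (PowerSeries.mk fun n => PowerSeries.coeff n (ker1 a * F) / (n : ℝ)))
      = q • PowerSeries.coeff n (PowerSeries.mk fun n => PowerSeries.coeff n (ker1 a * F) / (n : ℝ)) := rfl
    simp only [RingHom.id_apply, h2, PowerSeries.coeff_mk, Rat.smul_def]; ring

lemma JP_coeff (a : Bool) (F : PowerSeries ℝ) (n : ℕ) :
    PowerSeries.coeff n (JP a F) = PowerSeries.coeff n (ker1 a * F) / n := by
  simp [JP]

lemma JP_zero (a : Bool) (F : PowerSeries ℝ) : PowerSeries.coeff 0 (JP a F) = 0 := by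
  rw [JP_coeff]; simp

lemma thP_JP (a : Bool) (F : PowerSeries ℝ) (h : a = false → PowerSeries.coeff 0 F = 0) :
    thP (JP a F) = ker1 a * F := by
  ext n
  simp only [thP, PowerSeries.coeff_mk, JP_coeff]
  rcases Nat.eq_zero_or_pos n with rfl | hn
  · cases a
    · have := h rfl
      simp_all [ker1]
    · simp [PowerSeries.coeff_mul, ker1]
  · field_simp

lemma coeff_zero_mul' (F G : PowerSeries ℝ) : PowerSeries.coeff 0 (F * G) =
    PowerSeries.coeff 0 F * PowerSeries.coeff 0 G := by simp [PowerSeries.coeff_mul]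

lemma JP_mul (a b : Bool) (F G : PowerSeries ℝ) (ha : a = false → PowerSeries.coeff 0 F = 0)
    (hb : b = false → PowerSeries.coeff 0 G = 0) :
    JP a F * JP b G = JP a (F * JP b G) + JP b (JP a F * G) := by
  apply thP_inj
  · rw [thP_mul, thP_add, thP_JP a F ha, thP_JP b G hb, thP_JP, thP_JP]
    · ring
    · intro _; rw [coeff_zero_mul', JP_zero, zero_mul]
    · intro _; rw [coeff_zero_mul', JP_zero, mul_zero]
  · rw [map_add, coeff_zero_mul', JP_zero, JP_zero, JP_zero, JP_zero]; simp

noncomputable def LB : List Bool → PowerSeries ℝ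
  | [] => 1
  | a :: w => JP a (LB w)

def VB : List Bool → Prop
  | [] => True
  | a :: w => (w = [] → a = true) ∧ VB w

lemma LB_zero (a : Bool) (w : List Bool) (h : VB (a :: w)) (ha : a = false) :
    PowerSeries.coeff 0 (LB w) = 0 := by
  cases w with
  | nil => have := h.1 rfl; simp_all
  | cons b w => exact JP_zero _ _

noncomputable def EB : (List Bool →₀ ℚ) →ₗ[ℚ] PowerSeries ℝ :=
  Finsupp.linearCombination ℚ LB

lemma EB_cons (a : Bool) (X : List Bool →₀ ℚ) :
    EB (X.mapDomain (List.cons a)) = JP a (EB X) := by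
  unfold EB
  rw [Finsupp.linearCombination_mapDomain, Finsupp.linearCombination_apply,
    Finsupp.linearCombination_apply, map_finsuppSum]
  simp only [map_smul]
  rfl

lemma EB_shR (u v : List Bool) : VB u → VB v → EB (shR u v) = LB u * LB v := by
  induction u, v using shR.induct with
  | case1 w => intro _ _; simp [shR, EB, LB]
  | case2 a w => intro _ _; simp [shR, EB, LB]
  | case3 a u b v ih1 ih2 =>
    intro hu hv
    rw [shR, map_add, EB_cons, EB_cons, ih1 hu.2 hv, ih2 hu hv.2]
    exact (JP_mul a b (LB u) (LB v) (LB_zero a u hu) (LB_zero b v hv)).symm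

lemma shR_supp (u v : List Bool) : VB u → VB v →
    ∀ w ∈ (shR u v).support, VB w ∧ w.length = u.length + v.length := by
  induction u, v using shR.induct with
  | case1 w =>
    intro _ h x hx
    rw [shR] at hx
    have := Finset.mem_singleton.mp (Finsupp.support_single_subset hx)
    subst this; simp [h]
  | case2 a w =>
    intro h _ x hx
    rw [shR] at hx
    have := Finset.mem_singleton.mp (Finsupp.support_single_subset hx)
    subst this; simp [h]
  | case3 a u b v ih1 ih2 =>
    intro hu hv w hw
    rw [shR] at hw
    rcases Finset.mem_union.mp (Finsupp.support_add hw) with hw | hw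
    · obtain ⟨x, hx, rfl⟩ := Finset.mem_image.mp (Finsupp.mapDomain_support hw)
      obtain ⟨h1, h2⟩ := ih1 hu.2 hv x hx
      refine ⟨⟨fun h => ?_, h1⟩, ?_⟩
      · subst h; simp only [List.length_nil, List.length_cons] at h2; omega
      · simp [h2]; omega
    · obtain ⟨x, hx, rfl⟩ := Finset.mem_image.mp (Finsupp.mapDomain_support hw)
      obtain ⟨h1, h2⟩ := ih2 hu hv.2 x hx
      refine ⟨⟨fun h => ?_, h1⟩, ?_⟩
      · subst h; simp only [List.length_nil, List.length_cons] at h2; omega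
      · simp [h2]; omega

/-- reversed word of a reversed index -/
def rwd : List ℕ → List Bool
  | [] => []
  | a :: w => List.replicate (a - 1) false ++ true :: rwd w

lemma rwd_append (u v : List ℕ) : rwd (u ++ v) = rwd u ++ rwd v := by
  induction u with
  | nil => rfl
  | cons a u ih => simp [rwd, ih]

lemma wordOf_reverse (k : List ℕ) : (wordOf k).reverse = rwd k.reverse := by
  induction k with
  | nil => rfl
  | cons a k ih =>
    have : wordOf (a :: k) = (true :: List.replicate (a - 1) false) ++ wordOf k := by
      simp [wordOf]
    rw [this, List.reverse_append, ih]
    simp [rwd, rwd_append]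

lemma VB_rep (j : ℕ) (w : List Bool) (h : VB w) (hw : w ≠ []) :
    VB (List.replicate j false ++ w) := by
  induction j with
  | zero => simpa
  | succ j ih =>
    rw [List.replicate_succ, List.cons_append]
    refine ⟨fun h => ?_, ih⟩
    simp_all

lemma VB_rwd (w : List ℕ) : VB (rwd w) := by
  induction w with
  | nil => trivial
  | cons a w ih => exact VB_rep _ _ ⟨fun _ => rfl, ih⟩ (by simp)

lemma decode_aux (w : List Bool) :
    w = List.replicate (w.foldr (fun b p => if b then (0, (p.1 + 1) :: p.2) else (p.1 + 1, p.2))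
    ((0, []) : ℕ × List ℕ)).1 false ++ wordOf (decode w) := by
  induction w with
  | nil => simp [decode, wordOf]
  | cons b w ih =>
    cases b
    · simp only [decode, List.foldr_cons] at ih ⊢
      simpa [List.replicate_succ] using ih
    · simp only [decode, List.foldr_cons] at ih ⊢
      simpa [wordOf] using ih

lemma VB_last (w : List Bool) : ∀ h : w ≠ [], VB w → w.getLast h = true := by
  induction w with
  | nil => intro h; simp at h
  | cons a w ih =>
    intro h hv
    by_cases hw : w = []
    · subst hw; simpa using hv.1 rfl
    · rw [List.getLast_cons hw]; exact ih hw hv.2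

lemma rwd_decode (w : List Bool) (h : VB w) : rwd (decode w.reverse).reverse = w := by
  rw [← wordOf_reverse]
  have := decode_aux w.reverse
  set j := (w.reverse.foldr (fun b p => if b then (0, (p.1 + 1) :: p.2) else (p.1 + 1, p.2))
    ((0, []) : ℕ × List ℕ)).1 with hj
  rcases Nat.eq_zero_or_pos j with h0 | h0
  · rw [h0] at this
    simp only [List.replicate_zero, List.nil_append] at this
    rw [← this, List.reverse_reverse]
  · exfalso
    obtain ⟨i, hi⟩ := Nat.exists_eq_succ_of_ne_zero h0.ne'
    rw [hi] at this
    have h2 : w = (wordOf (decode w.reverse)).reverse ++ List.replicate (i+1) false := by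
      have := congrArg List.reverse this
      simpa using this
    have hne : w ≠ [] := by rw [h2]; simp
    have h3 := VB_last w hne h
    have h4 : w.getLast? = some true := by rw [List.getLast?_eq_some_getLast hne, h3]
    rw [h2, List.replicate_succ'] at h4
    simp at h4

lemma decode_pos (w : List Bool) : ∀ x ∈ decode w, 0 < x := by
  induction w with
  | nil => simp [decode]
  | cons b w ih =>
    cases b
    · simpa [decode] using ih
    · simpa [decode] using ih

/-- coefficients -/
noncomputable def ell : List ℕ → ℕ → ℝ
  | [], n => if n = 0 then 1 else 0
  | a :: w, n => Mr w n * eT a n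

lemma sum_ell (w : List ℕ) (N : ℕ) (hN : 0 < N) : ∑ n ∈ Finset.range N, ell w n = Mr w N := by
  cases w with
  | nil => simp [ell, Mr, hN]
  | cons a w => rfl

lemma coeff_LB_rep (j : ℕ) (w : List Bool) (n : ℕ) :
    PowerSeries.coeff n (LB (List.replicate j false ++ w)) =
      PowerSeries.coeff n (LB w) / (n : ℝ) ^ j := by
  induction j with
  | zero => simp
  | succ j ih =>
    rw [List.replicate_succ, List.cons_append, LB, JP_coeff]
    simp only [ker1, one_mul, ih]
    rw [pow_succ, div_div]

lemma coeff_ker_true (F : PowerSeries ℝ) (n : ℕ) :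
    PowerSeries.coeff n (ker1 true * F) = ∑ m ∈ Finset.range n, PowerSeries.coeff m F := by
  rw [mul_comm, PowerSeries.coeff_mul,
    Finset.Nat.sum_antidiagonal_eq_sum_range_succ_mk, Finset.sum_range_succ]
  simp only [ker1, PowerSeries.coeff_mk]
  simp only [Nat.sub_self, if_true, mul_zero, add_zero]
  refine Finset.sum_congr rfl fun m hm => ?_
  have : n - m ≠ 0 := by have := Finset.mem_range.mp hm; omega
  simp [this]

lemma coeff_LB (w : List ℕ) (hw : ∀ x ∈ w, 0 < x) :
    ∀ n, PowerSeries.coeff n (LB (rwd w)) = ell w n := by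
  induction w with
  | nil => intro n; simp [rwd, LB, ell, PowerSeries.coeff_one]
  | cons a w ih =>
    intro n
    have ih' := ih (fun x hx => hw x (by simp [hx]))
    have ha : 0 < a := hw a (by simp)
    rw [rwd, coeff_LB_rep, LB, JP_coeff, coeff_ker_true]
    simp only [ih']
    rw [ell, eT]
    rcases Nat.eq_zero_or_pos n with rfl | hn
    · simp
    · rw [sum_ell w n hn, if_neg hn.ne', div_div, ← pow_succ', Nat.sub_add_cancel ha,
        div_eq_mul_inv]

/-- truncated sums of coefficients -/
lemma EN_shW (u v : List ℕ) (hu : ∀ x ∈ u, 0 < x) (hv : ∀ x ∈ v, 0 < x) (N : ℕ) (hN : 0 < N) :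
    EN N ((shW (wordOf u) (wordOf v)).mapDomain decode) =
      ∑ n ∈ Finset.range N, ∑ p ∈ Finset.HasAntidiagonal.antidiagonal n,
        ell u.reverse p.1 * ell v.reverse p.2 := by
  have key : ∀ n, PowerSeries.coeff n (EB (shR (rwd u.reverse) (rwd v.reverse))) =
      ∑ p ∈ Finset.HasAntidiagonal.antidiagonal n, ell u.reverse p.1 * ell v.reverse p.2 := by
    intro n
    rw [EB_shR _ _ (VB_rwd _) (VB_rwd _), PowerSeries.coeff_mul]
    refine Finset.sum_congr rfl fun p _ => ?_
    rw [coeff_LB _ (by simpa using hu), coeff_LB _ (by simpa using hv)]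
  simp only [← key]
  rw [shW, wordOf_reverse, wordOf_reverse, EN, Finsupp.linearCombination_mapDomain,
    Finsupp.linearCombination_mapDomain, EB]
  simp only [Finsupp.linearCombination_apply, Finsupp.sum, map_sum]
  rw [Finset.sum_comm]
  refine Finset.sum_congr rfl fun w hw => ?_
  have hV := (shR_supp _ _ (VB_rwd _) (VB_rwd _) w hw).1
  have h1 : ∀ (n : ℕ) (q : ℚ) (F : PowerSeries ℝ),
    PowerSeries.coeff n (q • F) = q • PowerSeries.coeff n F := fun _ _ _ => rfl
  simp only [h1, ← Finset.smul_sum, Function.comp]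
  congr 1
  rw [← sum_ell _ N hN]
  refine Finset.sum_congr rfl fun n _ => ?_
  rw [← coeff_LB _ (by simpa using decode_pos _), rwd_decode w hV]

/-! ### Analysis -/

open Filter Topology Asymptotics

lemma hh_succ_eq (N : ℕ) : hh (N + 1) = ((harmonic N : ℚ) : ℝ) := by
  rw [hh_eq, Finset.sum_range_succ']
  simp [eT, harmonic]

lemma hh_le_log (N : ℕ) : hh N ≤ 1 + Real.log N := by
  refine (hh_mono (Nat.le_succ N)).trans ?_
  rw [Nat.succ_eq_add_one, hh_succ_eq]
  exact harmonic_le_one_add_log N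

lemma hh_tendsto : Tendsto hh atTop atTop := by
  rw [← tendsto_add_atTop_iff_nat 1]
  refine Real.tendsto_sum_range_one_div_nat_succ_atTop.congr fun N => ?_
  rw [hh_succ_eq]; simp [harmonic]

lemma hh_growth (m : ℕ) :
    (fun N : ℕ => (1 + hh N) ^ m) =O[atTop] fun N : ℕ => (N : ℝ) ^ (1 / 2 : ℝ) := by
  have hc : (0 : ℝ) < 1 / (2 * (m + 1)) := by positivity
  have h1 : (fun x : ℝ => 2 + Real.log x) =O[atTop] fun x => x ^ (1 / (2 * (m + 1)) : ℝ) := by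
    refine IsBigO.add ?_ (isLittleO_log_rpow_atTop hc).isBigO
    refine IsLittleO.isBigO ?_
    rw [isLittleO_const_left]
    right
    exact tendsto_norm_atTop_atTop.comp (tendsto_rpow_atTop hc)
  have h2 := (h1.pow (m + 1)).comp_tendsto tendsto_natCast_atTop_atTop
  refine IsBigO.trans ?_ (h2.trans ?_)
  · refine IsBigO.of_bound 1 ?_
    filter_upwards [] with N
    have h0 := hh_nonneg N
    have h3 := hh_le_log N
    simp only [Function.comp]
    rw [Real.norm_of_nonneg (by positivity), Real.norm_of_nonneg (pow_nonneg (by linarith) _),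
      one_mul]
    calc (1 + hh N) ^ m ≤ (1 + hh N) ^ (m + 1) := pow_le_pow_right₀ (by linarith) (by omega)
      _ ≤ _ := pow_le_pow_left₀ (by linarith) (by linarith) _
  · refine (isBigO_refl _ _).congr_left fun N => ?_
    simp only [Function.comp]
    rw [← Real.rpow_natCast, ← Real.rpow_mul (Nat.cast_nonneg N)]
    congr 1
    push_cast
    field_simp

lemma growth_div (m : ℕ) : Tendsto (fun N : ℕ => (1 + hh N) ^ m / N) atTop (𝓝 0) := by
  have h1 : (fun N : ℕ => (1 + hh N) ^ m / N) =O[atTop] fun N : ℕ => (N : ℝ) ^ (-(1 / 2) : ℝ) := by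
    have := (hh_growth m).mul (isBigO_refl (fun N : ℕ => ((N : ℝ))⁻¹) atTop)
    refine this.trans (IsBigO.of_bound 1 ?_)
    filter_upwards [eventually_gt_atTop 0] with N hN
    have hN' : (0 : ℝ) < N := by exact_mod_cast hN
    rw [one_mul, ← Real.rpow_neg_one, ← Real.rpow_add hN']
    norm_num
  refine h1.trans_tendsto ?_
  exact (tendsto_rpow_neg_atTop (by norm_num : (0 : ℝ) < 1 / 2)).comp tendsto_natCast_atTop_atTop

/-- reversed admissible indices -/
def AdmR (w : List ℕ) : Prop := (∀ x ∈ w, 0 < x) ∧ ∀ x, w.head? = some x → 2 ≤ x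

lemma ell_nonneg (w : List ℕ) (n : ℕ) : 0 ≤ ell w n := by
  cases w with
  | nil => simp only [ell]; split_ifs <;> norm_num
  | cons a w => exact mul_nonneg (Mr_nonneg _ _) (eT_nonneg _ _)

lemma ell_le (w : List ℕ) (hw : ∀ x ∈ w, 0 < x) (b : ℕ) (hb : ∀ x, w.head? = some x → b ≤ x)
    (n N : ℕ) (hn : 0 < n) (hN : n ≤ N) : ell w n ≤ (1 + hh N) ^ w.length * eT b n := by
  have h0 := hh_nonneg N
  cases w with
  | nil => simpa [ell, hn.ne'] using eT_nonneg b n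
  | cons a w =>
    simp only [ell]
    have h1 := Mr_le w (fun x hx => hw x (by simp [hx])) N
    have h2 := Mr_mono w hN
    refine mul_le_mul ?_ (eT_anti (hb a (by simp)) n) (eT_nonneg _ _) (by positivity)
    refine (h2.trans h1).trans (pow_le_pow_right₀ (by linarith) (by simp))

lemma ell_summable (w : List ℕ) (hw : AdmR w) (m : ℕ) : Summable fun n => hh n ^ m * ell w n := by
  have hs : Summable fun n : ℕ => (n : ℝ) ^ (-(3 / 2) : ℝ) := Real.summable_nat_rpow.mpr (by norm_num)
  refine summable_of_isBigO_nat hs ?_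
  have h1 := (hh_growth (m + w.length)).mul (isBigO_refl (fun N : ℕ => eT 2 N) atTop)
  refine IsBigO.trans (IsBigO.of_bound 1 ?_) (h1.trans (IsBigO.of_bound 1 ?_))
  · filter_upwards [eventually_gt_atTop 0] with n hn
    have h0 := hh_nonneg n
    rw [Real.norm_of_nonneg (mul_nonneg (by positivity) (ell_nonneg _ _)),
      Real.norm_of_nonneg (mul_nonneg (by positivity) (eT_nonneg _ _)), one_mul, pow_add, mul_assoc]
    refine mul_le_mul (pow_le_pow_left₀ h0 (by linarith) _)
      (ell_le w hw.1 2 hw.2 n n hn le_rfl) (ell_nonneg _ _) (by positivity)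
  · filter_upwards [eventually_gt_atTop 0] with N hN
    have hN' : (0 : ℝ) < N := by exact_mod_cast hN
    have : eT 2 N = (N : ℝ) ^ (-2 : ℝ) := by
      rw [eT, if_neg hN.ne', Real.rpow_neg hN'.le]; norm_cast
    rw [this, one_mul, ← Real.rpow_add hN']
    norm_num

def Sml (x : ℕ → ℝ) : Prop := ∀ m : ℕ, Tendsto (fun N => hh N ^ m * x N) atTop (𝓝 0)

lemma Sml.add {x y : ℕ → ℝ} (hx : Sml x) (hy : Sml y) : Sml fun N => x N + y N := fun m => by
  simpa [mul_add] using (hx m).add (hy m)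

lemma Sml.const_mul {x : ℕ → ℝ} (c : ℝ) (hx : Sml x) : Sml fun N => c * x N := fun m => by
  simpa [mul_left_comm] using (hx m).const_mul c

lemma Sml.tendsto {x : ℕ → ℝ} (hx : Sml x) : Tendsto x atTop (𝓝 0) := by
  simpa using hx 0

lemma Sml.mul {x y : ℕ → ℝ} (hx : Sml x) (hy : Sml y) : Sml fun N => x N * y N := fun m => by
  simpa [mul_assoc] using (hx m).mul hy.tendsto

lemma Sml.poly {x : ℕ → ℝ} (hx : Sml x) (P : Polynomial ℝ) : Sml fun N => P.eval (hh N) * x N := by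
  induction P using Polynomial.induction_on' with
  | add p q hp hq => simpa [add_mul] using hp.add hq
  | monomial n a =>
    intro m
    have := (hx (m + n)).const_mul a
    simp only [mul_zero] at this
    refine this.congr fun N => ?_
    simp only [Polynomial.eval_monomial]; ring

lemma Sml_tail (w : List ℕ) (hw : AdmR w) : Sml fun N => Mr w N - ∑' n, ell w n := by
  have hs : Summable (ell w) := by simpa using ell_summable w hw 0
  intro m
  have h1 : Tendsto (fun N => ∑' n, hh (n + N) ^ m * ell w (n + N)) atTop (𝓝 0) :=
    tendsto_sum_nat_add fun n => hh n ^ m * ell w n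
  refine squeeze_zero_norm' ?_ h1
  filter_upwards [eventually_gt_atTop 0] with N hN
  have h2 := hs.sum_add_tsum_nat_add N
  rw [sum_ell w N hN] at h2
  have h3 : Mr w N - ∑' n, ell w n = -∑' n, ell w (n + N) := by linarith
  have h0 := hh_nonneg N
  have h4 : 0 ≤ ∑' n, ell w (n + N) := tsum_nonneg fun n => ell_nonneg _ _
  rw [h3, mul_neg, norm_neg, Real.norm_of_nonneg (by positivity), ← tsum_mul_left]
  refine Summable.tsum_le_tsum (fun n => ?_) (((summable_nat_add_iff N).mpr hs).mul_left _)
    ((summable_nat_add_iff (f := fun n => hh n ^ m * ell w n) N).mpr (ell_summable w hw m))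
  have := hh_mono (Nat.le_add_left N n)
  have := ell_nonneg w (n + N)
  gcongr

lemma antidiag_sum (F : ℕ → ℕ → ℝ) (N : ℕ) :
    ∑ n ∈ Finset.range N, ∑ p ∈ Finset.HasAntidiagonal.antidiagonal n, F p.1 p.2 =
      ∑ j ∈ Finset.range N, ∑ i ∈ Finset.range N, if N ≤ i + j then 0 else F i j := by
  rw [Finset.sum_comm, ← Finset.sum_product', Finset.sum_sigma']
  simp_rw [← not_lt, ite_not]
  rw [← Finset.sum_filter]
  refine Finset.sum_nbij' (fun x => x.2) (fun p => ⟨p.1 + p.2, p⟩) ?_ ?_ ?_ ?_ ?_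
  · rintro ⟨n, i, j⟩ h
    simp only [Finset.mem_sigma, Finset.mem_range, Finset.HasAntidiagonal.mem_antidiagonal,
      Finset.mem_filter, Finset.mem_product] at h ⊢
    omega
  · rintro ⟨i, j⟩ h
    simp only [Finset.mem_sigma, Finset.mem_range, Finset.HasAntidiagonal.mem_antidiagonal,
      Finset.mem_filter, Finset.mem_product] at h ⊢
    exact ⟨h.2, trivial⟩
  · rintro ⟨n, i, j⟩ h
    simp only [Finset.mem_sigma, Finset.mem_range, Finset.HasAntidiagonal.mem_antidiagonal] at h
    obtain ⟨_, rfl⟩ := h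
    rfl
  · rintro ⟨i, j⟩ h; rfl
  · rintro ⟨n, i, j⟩ h; rfl

lemma count_le (j N : ℕ) :
    ∑ i ∈ Finset.range N, (if N ≤ i + j then eT 2 j else 0) ≤ eT 1 j := by
  rw [← Finset.sum_filter, Finset.sum_const, nsmul_eq_mul]
  have hc : ((Finset.range N).filter fun i => N ≤ i + j).card ≤ j := by
    have : (Finset.range N).filter (fun i => N ≤ i + j) ⊆ Finset.Ico (N - j) N := by
      intro i hi
      simp only [Finset.mem_filter, Finset.mem_range, Finset.mem_Ico] at hi ⊢
      omega
    refine (Finset.card_le_card this).trans ?_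
    rw [Nat.card_Ico]; omega
  have hc' : (((Finset.range N).filter fun i => N ≤ i + j).card : ℝ) ≤ j := by exact_mod_cast hc
  refine (mul_le_mul_of_nonneg_right hc' (eT_nonneg 2 j)).trans (le_of_eq ?_)
  unfold eT
  split_ifs with h
  · simp
  · have : (j : ℝ) ≠ 0 := by exact_mod_cast h
    field_simp

lemma D_bound (u v : List ℕ) (hu : ∀ x ∈ u, 0 < x) (hv : AdmR v) (N : ℕ) (hN : 0 < N) :
    |Mr u N * Mr v N - ∑ n ∈ Finset.range N, ∑ p ∈ Finset.HasAntidiagonal.antidiagonal n,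
      ell u p.1 * ell v p.2| ≤ (1 + hh N) ^ (u.length + v.length + 2) / N := by
  have h0 := hh_nonneg N
  have hN' : (0 : ℝ) < N := by exact_mod_cast hN
  set K := (1 + hh N) ^ (u.length + v.length) / N with hK
  have hK0 : 0 ≤ K := by positivity
  have e1 : Mr u N * Mr v N - ∑ n ∈ Finset.range N, ∑ p ∈ Finset.HasAntidiagonal.antidiagonal n,
      ell u p.1 * ell v p.2 =
      ∑ j ∈ Finset.range N, ∑ i ∈ Finset.range N, if N ≤ i + j then ell u i * ell v j else 0 := by
    rw [antidiag_sum (fun i j => ell u i * ell v j), ← sum_ell u N hN, ← sum_ell v N hN,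
      Finset.sum_mul_sum, Finset.sum_comm, ← Finset.sum_sub_distrib]
    refine Finset.sum_congr rfl fun j _ => ?_
    rw [← Finset.sum_sub_distrib]
    refine Finset.sum_congr rfl fun i _ => ?_
    split_ifs <;> simp
  rw [e1, abs_of_nonneg (Finset.sum_nonneg fun j _ => Finset.sum_nonneg fun i _ => by
    split_ifs
    · exact mul_nonneg (ell_nonneg _ _) (ell_nonneg _ _)
    · exact le_rfl)]
  calc _ ≤ ∑ j ∈ Finset.range N, ∑ i ∈ Finset.range N,
        K * (eT 1 i * eT 1 j + if N ≤ i + j then eT 2 j else 0) := by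
        refine Finset.sum_le_sum fun j hj => Finset.sum_le_sum fun i hi => ?_
        rw [Finset.mem_range] at hi hj
        split_ifs with h
        · have hi0 : 0 < i := by omega
          have hj0 : 0 < j := by omega
          have a1 := ell_le u hu 1 (fun x hx => hu x (List.mem_of_mem_head? hx)) i N hi0 hi.le
          have a2 := ell_le v hv.1 2 hv.2 j N hj0 hj.le
          refine (mul_le_mul a1 a2 (ell_nonneg _ _)
            (mul_nonneg (by positivity) (eT_nonneg _ _))).trans ?_
          have hi' : (0 : ℝ) < i := by exact_mod_cast hi0
          have hj' : (0 : ℝ) < j := by exact_mod_cast hj0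
          have hij : (N : ℝ) ≤ i + j := by exact_mod_cast h
          have : eT 1 i * eT 2 j ≤ (eT 1 i * eT 1 j + eT 2 j) / N := by
            simp only [eT, hi0.ne', hj0.ne', if_false]
            rw [le_div_iff₀ hN']
            field_simp
            linarith
          calc _ = (1 + hh N) ^ (u.length + v.length) * (eT 1 i * eT 2 j) := by rw [pow_add]; ring
            _ ≤ (1 + hh N) ^ (u.length + v.length) * ((eT 1 i * eT 1 j + eT 2 j) / N) := by gcongr
            _ = _ := by rw [hK]; ring
        · have := eT_nonneg 1 i
          have := eT_nonneg 1 j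
          positivity
    _ ≤ ∑ j ∈ Finset.range N, K * (hh N * eT 1 j + eT 1 j) := by
        refine Finset.sum_le_sum fun j _ => ?_
        rw [← Finset.mul_sum, Finset.sum_add_distrib, ← Finset.sum_mul, ← hh_eq]
        gcongr
        exact count_le j N
    _ = K * (hh N * hh N + hh N) := by
        rw [← Finset.mul_sum, Finset.sum_add_distrib, ← Finset.mul_sum, ← hh_eq]
    _ ≤ K * (1 + hh N) ^ 2 := by gcongr; nlinarith
    _ = _ := by rw [hK, pow_add _ _ 2]; ring

lemma D_tendsto (u v : List ℕ) (hu : ∀ x ∈ u, 0 < x) (hv : ∀ x ∈ v, 0 < x)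
    (hv2 : ∀ x, v.getLast? = some x → 2 ≤ x) :
    Tendsto (fun N => EN N (harmW u v) - EN N ((shW (wordOf u) (wordOf v)).mapDomain decode))
      atTop (𝓝 0) := by
  refine squeeze_zero_norm' ?_ (growth_div (u.reverse.length + v.reverse.length + 2))
  filter_upwards [eventually_gt_atTop 0] with N hN
  rw [EN_harmW, EN_shW u v hu hv N hN]
  exact D_bound _ _ (by simpa using hu) ⟨by simpa using hv, by simpa using hv2⟩ N hN

/-! ### zeta values -/

noncomputable def GF (N : ℕ) : ℕ → List ℕ → ℝ
  | _, [] => 1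
  | m, a :: k => ∑ n ∈ Finset.Ioo m N, eT a n * GF N n k

lemma GF_append (k : List ℕ) (a : ℕ) : ∀ N m, GF N m (k ++ [a]) =
    ∑ n ∈ Finset.Ioo m N, GF n m k * eT a n := by
  induction k with
  | nil => intro N m; simp [GF]
  | cons b k ih =>
    intro N m
    simp only [List.cons_append, GF, ih, Finset.mul_sum, Finset.sum_mul]
    rw [Finset.sum_comm' (t' := Finset.Ioo m N) (s' := fun n => Finset.Ioo m n)]
    · refine Finset.sum_congr rfl fun n _ => Finset.sum_congr rfl fun p _ => by ring
    · intro p n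
      simp only [Finset.mem_Ioo]; omega

lemma GF_eq_Mr (w : List ℕ) : ∀ N, GF N 0 w.reverse = Mr w N := by
  induction w with
  | nil => intro N; simp [GF, Mr]
  | cons a w ih =>
    intro N
    rw [List.reverse_cons, GF_append]
    simp only [ih, Mr]
    refine Finset.sum_subset (fun n hn => by simp at hn ⊢; omega) fun n hn hn' => ?_
    have : n = 0 := by simp at hn hn'; omega
    simp [this, eT]

noncomputable def tupS (r m N : ℕ) : Finset (Fin r → ℕ) :=
  (Fintype.piFinset fun _ => Finset.Ioo m N).filter StrictMono

lemma mem_tupS {r m N : ℕ} (n : Fin r → ℕ) :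
    n ∈ tupS r m N ↔ (∀ i, m < n i ∧ n i < N) ∧ StrictMono n := by
  simp [tupS]

lemma strictMono_cons {r : ℕ} (p : ℕ) (n : Fin r → ℕ) :
    StrictMono (Fin.cons p n : Fin (r + 1) → ℕ) ↔ (∀ i, p < n i) ∧ StrictMono n := by
  constructor
  · intro h
    refine ⟨fun i => ?_, fun i j hij => ?_⟩
    · simpa using h (Fin.succ_pos i)
    · simpa using h (Fin.succ_lt_succ_iff.mpr hij)
  · rintro ⟨h1, h2⟩ i j hij
    induction j using Fin.cases with
    | zero => simp at hij
    | succ j =>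
      induction i using Fin.cases with
      | zero => simpa using h1 j
      | succ i => simpa using h2 (Fin.succ_lt_succ_iff.mp hij)

lemma GF_eq_sum (k : List ℕ) (N : ℕ) : ∀ m,
    GF N m k = ∑ n ∈ tupS k.length m N, ∏ i, (1 : ℝ) / (n i : ℝ) ^ k.get i := by
  induction k with
  | nil =>
    intro m
    have : tupS ([] : List ℕ).length m N = {Fin.elim0} := by
      ext n
      rw [mem_tupS]
      simp only [List.length_nil, Finset.mem_singleton]
      exact ⟨fun _ => funext fun i => i.elim0, fun _ => ⟨fun i => i.elim0, fun i => i.elim0⟩⟩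
    rw [this]; simp [GF]
  | cons a k ih =>
    intro m
    simp only [GF, ih, Finset.mul_sum]
    rw [Finset.sum_sigma']
    refine Finset.sum_nbij' (fun x => (Fin.cons x.1 x.2 : Fin (k.length + 1) → ℕ))
      (fun n => ⟨n 0, Fin.tail n⟩) ?_ ?_ ?_ ?_ ?_
    · rintro ⟨p, n⟩ h
      simp only [Finset.mem_sigma, Finset.mem_Ioo, mem_tupS] at h
      obtain ⟨⟨h1, h2⟩, h3, h4⟩ := h
      refine (mem_tupS _).mpr ⟨fun i => ?_, (strictMono_cons p n).mpr ⟨fun i => (h3 i).1, h4⟩⟩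
      induction i using Fin.cases with
      | zero => exact ⟨h1, h2⟩
      | succ i => exact ⟨h1.trans (h3 i).1, (h3 i).2⟩
    · intro n h
      obtain ⟨h1, h2⟩ := (mem_tupS (r := k.length + 1) n).mp h
      rw [← Fin.cons_self_tail n, strictMono_cons] at h2
      simp only [Finset.mem_sigma, Finset.mem_Ioo, mem_tupS]
      exact ⟨h1 0, fun i => ⟨h2.1 i, (h1 i.succ).2⟩, h2.2⟩
    · rintro ⟨p, n⟩ h; simp
    · intro n h; exact Fin.cons_self_tail n
    · rintro ⟨p, n⟩ h
      simp only [Finset.mem_sigma, Finset.mem_Ioo] at h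
      have hp : p ≠ 0 := by omega
      refine Eq.trans ?_ (Fin.prod_univ_succ (n := k.length) _).symm
      simp [eT, hp]

lemma zetaIdx_eq (k : List ℕ) (hk : AdmR k.reverse) : zetaIdx k = ∑' n, ell k.reverse n := by
  have hlim : Tendsto (fun N => Mr k.reverse N) atTop (𝓝 (∑' n, ell k.reverse n)) := by
    have := (Sml_tail _ hk).tendsto.add_const (∑' n, ell k.reverse n)
    simpa using this
  set g : {n : Fin k.length → ℕ // (∀ i, 0 < n i) ∧ StrictMono n} → ℝ :=
    fun n => ∏ i, (1 : ℝ) / (n.1 i : ℝ) ^ k.get i with hg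
  have hg0 : ∀ n, 0 ≤ g n := fun n => Finset.prod_nonneg fun i _ => by positivity
  let S : ℕ → Finset {n : Fin k.length → ℕ // (∀ i, 0 < n i) ∧ StrictMono n} :=
    fun N => (tupS k.length 0 N).subtype _
  have hS : ∀ N, ∑ n ∈ S N, g n = Mr k.reverse N := by
    intro N
    rw [← GF_eq_Mr, List.reverse_reverse, GF_eq_sum]
    refine Finset.sum_subtype_of_mem (fun n : Fin k.length → ℕ => ∏ i, (1 : ℝ) / (n i : ℝ) ^ k.get i) ?_
    intro n hn
    obtain ⟨h1, h2⟩ := (mem_tupS n).mp hn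
    exact ⟨fun i => (h1 i).1, h2⟩
  have hSm : Monotone S := by
    intro N M h n hn
    simp only [S, Finset.mem_subtype, mem_tupS] at hn ⊢
    exact ⟨fun i => ⟨(hn.1 i).1, (hn.1 i).2.trans_le h⟩, hn.2⟩
  have hSe : ∀ n, ∃ N, n ∈ S N := by
    intro n
    refine ⟨(∑ i, n.1 i) + 1, ?_⟩
    simp only [S, Finset.mem_subtype, mem_tupS]
    refine ⟨fun i => ⟨n.2.1 i, Nat.lt_succ_of_le ?_⟩, n.2.2⟩
    exact Finset.single_le_sum (f := n.1) (fun _ _ => Nat.zero_le _) (Finset.mem_univ i)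
  have hT := tendsto_atTop_finset_of_monotone hSm hSe
  have hsum : Summable g := by
    refine summable_of_sum_le (c := ∑' n, ell k.reverse n) hg0 fun s => ?_
    obtain ⟨N, hN⟩ := (hT.eventually (eventually_ge_atTop s)).exists
    refine (Finset.sum_le_sum_of_subset_of_nonneg hN fun n _ _ => hg0 n).trans ?_
    rw [hS]
    exact (Mr_mono _).ge_of_tendsto hlim N
  have h1 : Tendsto (fun N => ∑ n ∈ S N, g n) atTop (𝓝 (∑' n, g n)) := hsum.hasSum.comp hT
  simp only [hS] at h1
  exact tendsto_nhds_unique h1 hlim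

noncomputable def ZL : (List ℕ →₀ ℚ) →ₗ[ℚ] ℝ := Finsupp.linearCombination ℚ zetaIdx

lemma ZL_eq (f : List ℕ →₀ ℚ) : ZReal f = ZL f := by
  simp [ZReal, ZL, Finsupp.linearCombination_apply, Rat.smul_def]

lemma Sml_ZL (f : List ℕ →₀ ℚ) (hf : MemH0 f) : Sml fun N => EN N f - ZL f := by
  have : ∀ s : Finset (List ℕ), (∀ w ∈ s, AdmR w.reverse) →
      Sml fun N => ∑ w ∈ s, (f w • Mr w.reverse N - f w • zetaIdx w) := by
    intro s
    induction s using Finset.induction_on with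
    | empty => intro _ m; simp
    | insert a s ha ih =>
      intro h
      simp only [Finset.sum_insert ha]
      refine Sml.add ?_ (ih fun w hw => h w (by simp [hw]))
      have h1 := (Sml_tail _ (h a (by simp))).const_mul (f a : ℝ)
      rw [← zetaIdx_eq a (h a (by simp))] at h1
      simpa [Rat.smul_def, mul_sub] using h1
  have h2 := this f.support fun w hw => ⟨by simpa using (hf w hw).1, by simpa using (hf w hw).2⟩
  simpa [EN, ZL, Finsupp.linearCombination_apply, Finsupp.sum, Finset.sum_sub_distrib] using h2

/-! ### Regularization -/

def leadOnes : List ℕ → ℕ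
  | [] => 0
  | a :: w => if a = 1 then leadOnes w + 1 else 0

def posW (w : List ℕ) : Prop := ∀ x ∈ w, 0 < x

noncomputable def supS (s : ℕ) : Submodule ℚ (List ℕ →₀ ℚ) :=
  Finsupp.supported ℚ ℚ {w | posW w ∧ leadOnes w ≤ s}

lemma single_mem_supS (s : ℕ) (w : List ℕ) (q : ℚ) (h : posW w) (h2 : leadOnes w ≤ s) :
    Finsupp.single w q ∈ supS s := Finsupp.single_mem_supported ℚ q ⟨h, h2⟩

lemma cons_mem_supS (s t b : ℕ) (hb : 0 < b) (X : List ℕ →₀ ℚ) (hX : X ∈ supS s)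
    (h : ∀ w, leadOnes w ≤ s → leadOnes (b :: w) ≤ t) : X.mapDomain (List.cons b) ∈ supS t := by
  rw [supS, Finsupp.mem_supported] at hX ⊢
  intro w hw
  obtain ⟨x, hx, rfl⟩ := Finset.mem_image.mp (Finsupp.mapDomain_support hw)
  obtain ⟨h1, h2⟩ := hX hx
  refine ⟨?_, h x h2⟩
  intro y hy
  rcases List.mem_cons.mp hy with rfl | hy
  · exact hb
  · exact h1 y hy

lemma stR_one (w : List ℕ) : posW w →
    stR [1] w - ((leadOnes w : ℚ) + 1) • Finsupp.single (1 :: w) 1 ∈ supS (leadOnes w) := by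
  induction w with
  | nil => intro _; simp [stR, leadOnes]
  | cons b w ih =>
    intro hw
    have hw' : posW w := fun x hx => hw x (by simp [hx])
    have hb : 0 < b := hw b (by simp)
    have ih' := ih hw'
    have e : stR [1] (b :: w) = Finsupp.single (1 :: b :: w) 1 + (stR [1] w).mapDomain (List.cons b)
        + Finsupp.single ((1 + b) :: w) 1 := by
      rw [stR, stR, stR]; simp [Finsupp.mapDomain_single]
    have h3 : ∀ t, Finsupp.single ((1 + b) :: w) (1 : ℚ) ∈ supS t := by
      intro t
      refine single_mem_supS _ _ _ ?_ ?_
      · intro y hy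
        rcases List.mem_cons.mp hy with rfl | hy
        · omega
        · exact hw' y hy
      · have : 1 + b ≠ 1 := by omega
        rw [leadOnes, if_neg this]; exact Nat.zero_le _
    rw [e]
    by_cases h1 : b = 1
    · subst h1
      have h4 := cons_mem_supS (leadOnes w) (leadOnes (1 :: w)) 1 hb _ ih'
        (fun x hx => by simpa [leadOnes] using hx)
      have h5 := Submodule.add_mem _ h4 (h3 (leadOnes (1 :: w)))
      convert h5 using 1
      rw [sub_eq_add_neg (stR [1] w), Finsupp.mapDomain_add, ← neg_smul, Finsupp.mapDomain_smul,
        Finsupp.mapDomain_single]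
      simp only [leadOnes, if_true]
      push_cast
      module
    · have h6 : stR [1] w ∈ supS (leadOnes w + 1) := by
        have hmono : supS (leadOnes w) ≤ supS (leadOnes w + 1) :=
          Finsupp.supported_mono fun x hx => ⟨hx.1, hx.2.trans (Nat.le_succ _)⟩
        have h7 : Finsupp.single (1 :: w) (1 : ℚ) ∈ supS (leadOnes w + 1) := by
          refine single_mem_supS _ _ _ ?_ (by simp [leadOnes])
          intro y hy
          rcases List.mem_cons.mp hy with rfl | hy
          · omega
          · exact hw' y hy
        have := Submodule.add_mem _ (hmono ih') (Submodule.smul_mem _ ((leadOnes w : ℚ) + 1) h7)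
        simpa using this
      have h4 := cons_mem_supS _ (leadOnes (b :: w)) b hb _ h6
        (fun x _ => by simp [leadOnes, h1])
      have h5 := Submodule.add_mem _ h4 (h3 (leadOnes (b :: w)))
      convert h5 using 1
      simp only [leadOnes, h1, if_false]
      push_cast
      module

lemma harmLin_single (u v : List ℕ) :
    harmLin (Finsupp.single u 1) (Finsupp.single v 1) = harmW u v := by
  simp [harmLin]

section
variable (R : (List ℕ →₀ ℚ) →ₗ[ℚ] (List ℕ →₀ ℚ))

def GoodR (f : List ℕ →₀ ℚ) : Prop :=
  ∃ P : Polynomial ℝ, P.eval 0 = ZL (R f) ∧ Sml fun N => EN N f - P.eval (hh N)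

lemma GoodR.add {f g : List ℕ →₀ ℚ} (hf : GoodR R f) (hg : GoodR R g) : GoodR R (f + g) := by
  obtain ⟨P, h1, h2⟩ := hf
  obtain ⟨Q, h3, h4⟩ := hg
  refine ⟨P + Q, by simp [h1, h3], ?_⟩
  convert h2.add h4 using 2
  simp only [map_add, Polynomial.eval_add]; ring

lemma GoodR.smul {f : List ℕ →₀ ℚ} (q : ℚ) (hf : GoodR R f) : GoodR R (q • f) := by
  obtain ⟨P, h1, h2⟩ := hf
  refine ⟨Polynomial.C (q : ℝ) * P, by simp [h1, Rat.smul_def], ?_⟩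
  convert h2.const_mul (q : ℝ) using 2
  simp only [map_smul, Polynomial.eval_mul, Polynomial.eval_C, Rat.smul_def]; ring

lemma GoodR.zero : GoodR R 0 := ⟨0, by simp, fun m => by simp⟩

def GoodS : Submodule ℚ (List ℕ →₀ ℚ) where
  carrier := {f | GoodR R f}
  add_mem' := GoodR.add R
  zero_mem' := GoodR.zero R
  smul_mem' := fun q _ h => GoodR.smul R q h

lemma GoodR.harm (hR0 : ∀ x, MemH0 (R x))
    (hRmul : ∀ x y, R (harmLin x y) = harmLin (R x) (R y)) {f g : List ℕ →₀ ℚ}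
    (hf : GoodR R f) (hg : GoodR R g) : GoodR R (harmLin f g) := by
  obtain ⟨P, h1, h2⟩ := hf
  obtain ⟨Q, h3, h4⟩ := hg
  refine ⟨P * Q, ?_, ?_⟩
  · have t : ∀ x, MemH0 x → Tendsto (fun N => EN N x) atTop (𝓝 (ZL x)) := fun x hx => by
      simpa using (Sml_ZL x hx).tendsto.add_const (ZL x)
    have a1 := (t _ (hR0 f)).mul (t _ (hR0 g))
    have a2 := t _ (hR0 (harmLin f g))
    rw [hRmul] at a2
    simp only [EN_harmLin] at a2
    rw [Polynomial.eval_mul, h1, h3, hRmul]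
    exact tendsto_nhds_unique a1 a2
  · convert ((h2.mul h4).add (h2.poly Q)).add (h4.poly P) using 2
    simp only [EN_harmLin, Polynomial.eval_mul]; ring

lemma good_supS (hR0 : ∀ x, MemH0 (R x)) (hRfix : ∀ x, MemH0 x → R x = x)
    (hRe1 : R (Finsupp.single [1] 1) = 0)
    (hRmul : ∀ x y, R (harmLin x y) = harmLin (R x) (R y)) (s : ℕ) :
    ∀ w, posW w → leadOnes w ≤ s → GoodR R (Finsupp.single w.reverse 1) := by
  have he1 : GoodR R (Finsupp.single [1] 1) := by
    refine ⟨Polynomial.X, by simp [hRe1], fun m => ?_⟩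
    simp [EN, hh]
  induction s with
  | zero =>
    intro w hw h
    have hm : MemH0 (Finsupp.single w.reverse 1) := by
      intro x hx
      have := Finset.mem_singleton.mp (Finsupp.support_single_subset hx)
      subst this
      refine ⟨by simpa [posW] using hw, fun x hx => ?_⟩
      cases w with
      | nil => simp at hx
      | cons a w =>
        simp only [List.getLast?_reverse, List.head?_cons, Option.some.injEq] at hx
        subst hx
        have h1 := hw a (by simp)
        by_contra h2
        have : a = 1 := by omega
        simp [leadOnes, this] at h
    refine ⟨Polynomial.C (ZL (Finsupp.single w.reverse 1)), by simp [hRfix _ hm], ?_⟩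
    simpa using Sml_ZL _ hm
  | succ s ih =>
    intro w hw h
    by_cases hs : leadOnes w ≤ s
    · exact ih w hw hs
    cases w with
    | nil => simp [leadOnes] at hs
    | cons a w =>
      have ha : a = 1 := by
        by_contra ha
        simp [leadOnes, ha] at hs
      subst ha
      have hw' : posW w := fun x hx => hw x (by simp [hx])
      have hl : leadOnes w = s := by simp [leadOnes] at hs h; omega
      have h1 := stR_one w hw'
      rw [hl] at h1
      have h2 : ∀ X ∈ supS s, GoodR R (X.mapDomain List.reverse) := by
        intro X hX
        rw [supS, Finsupp.mem_supported] at hX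
        have : X.mapDomain List.reverse =
            ∑ w ∈ X.support, X w • Finsupp.single w.reverse (1 : ℚ) := by
          simp [Finsupp.mapDomain, Finsupp.sum]
        rw [this]
        exact (GoodS R).sum_mem fun w hw =>
          (GoodS R).smul_mem _ (ih w (hX hw).1 (hX hw).2)
      have h3 := h2 _ h1
      have h4 := GoodR.harm R hR0 hRmul he1 (ih w hw' hl.le)
      rw [harmLin_single, harmW, List.reverse_reverse] at h4
      have h5 : GoodR R (((s : ℚ) + 1)⁻¹ • (Finsupp.mapDomain List.reverse (stR [1] w)
          + (-1 : ℚ) • Finsupp.mapDomain List.reverse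
          (stR [1] w - ((s : ℚ) + 1) • Finsupp.single (1 :: w) 1))) :=
        (GoodR.add R h4 (h3.smul R (-1))).smul R _
      convert h5 using 1
      have hs0 : ((s : ℚ) + 1) ≠ 0 := by positivity
      rw [sub_eq_add_neg, ← neg_smul, Finsupp.mapDomain_add, Finsupp.mapDomain_smul,
        Finsupp.mapDomain_single]
      have : ∀ A B : List ℕ →₀ ℚ, B = ((s : ℚ) + 1)⁻¹ • (A + (-1 : ℚ) • (A + -((s : ℚ) + 1) • B)) := by
        intro A B
        have : A + (-1 : ℚ) • (A + -((s : ℚ) + 1) • B) = ((s : ℚ) + 1) • B := by module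
        rw [this, smul_smul, inv_mul_cancel₀ hs0, one_smul]
      exact this _ _

lemma good_H1 (hR0 : ∀ x, MemH0 (R x)) (hRfix : ∀ x, MemH0 x → R x = x)
    (hRe1 : R (Finsupp.single [1] 1) = 0)
    (hRmul : ∀ x y, R (harmLin x y) = harmLin (R x) (R y)) (f : List ℕ →₀ ℚ) (hf : MemH1 f) :
    GoodR R f := by
  have : f = ∑ w ∈ f.support, f w • Finsupp.single w (1 : ℚ) := by
    conv_lhs => rw [← Finsupp.sum_single f]
    simp [Finsupp.sum]
  rw [this]
  refine (GoodS R).sum_mem fun w hw => (GoodS R).smul_mem _ ?_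
  have := good_supS R hR0 hRfix hRe1 hRmul _ w.reverse
    (fun x hx => hf w hw x (by simpa using hx)) le_rfl
  rwa [List.reverse_reverse] at this

end

lemma memH1_shIdx (f g : List ℕ →₀ ℚ) : MemH1 (shIdxLin f g) := by
  have h : shIdxLin f g ∈ Finsupp.supported ℚ ℚ {w : List ℕ | ∀ x ∈ w, 0 < x} := by
    unfold shIdxLin
    refine Submodule.sum_mem _ fun u _ => Submodule.sum_mem _ fun v _ => Submodule.smul_mem _ _ ?_
    rw [Finsupp.mem_supported]
    intro w hw
    obtain ⟨x, _, rfl⟩ := Finset.mem_image.mp (Finsupp.mapDomain_support hw)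
    exact decode_pos x
  rw [Finsupp.mem_supported] at h
  exact fun w hw => h hw

lemma main_tendsto (f g : List ℕ →₀ ℚ) (hf : MemH1 f) (hg : MemH0 g) :
    Tendsto (fun N => EN N (harmLin f g - shIdxLin f g)) atTop (𝓝 0) := by
  have : ∀ N, EN N (harmLin f g - shIdxLin f g) = ∑ u ∈ f.support, ∑ v ∈ g.support,
      ((f u * g v : ℚ) : ℝ) * (EN N (harmW u v) -
        EN N ((shW (wordOf u) (wordOf v)).mapDomain decode)) := by
    intro N
    simp only [harmLin, shIdxLin, Finsupp.sum, map_sub, map_sum, map_smul, mul_sub,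
      Finset.sum_sub_distrib, Rat.smul_def]
  simp only [this]
  rw [show (0 : ℝ) = ∑ u ∈ f.support, ∑ v ∈ g.support, ((f u * g v : ℚ) : ℝ) * 0 by simp]
  refine tendsto_finsetSum _ fun u hu => tendsto_finsetSum _ fun v hv => ?_
  exact (D_tendsto u v (hf u hu) (hg v hv).1 (hg v hv).2).const_mul _

/-- Extended double shuffle relation, harmonic regularization:
for any ℚ-linear map `R : 𝔥¹ → 𝔥¹` landing in `𝔥⁰`, restricting to the identity on
`𝔥⁰`, multiplicative for the harmonic product, and sending `e₁ ↦ 0` — i.e. for the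
harmonic regularization `reg_* : 𝔥¹_* → 𝔥⁰_*` (the constant term in `T = e₁` under
`𝔥¹_* ≅ 𝔥⁰_*[T]`) — one has `Z(reg_*(w₁ * w₀ − w₁ ⧢ w₀)) = 0` for all `w₁ ∈ 𝔥¹`,
`w₀ ∈ 𝔥⁰`. -/
theorem stmt_11 (R : (List ℕ →₀ ℚ) →ₗ[ℚ] (List ℕ →₀ ℚ))
    (hR0 : ∀ x, MemH0 (R x))
    (hRfix : ∀ x, MemH0 x → R x = x)
    (hRe1 : R (Finsupp.single [1] 1) = 0)
    (hRmul : ∀ x y, R (harmLin x y) = harmLin (R x) (R y))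
    (f g : List ℕ →₀ ℚ) (hf : MemH1 f) (hg : MemH0 g) :
    ZReal (R (harmLin f g - shIdxLin f g)) = 0 := by
  rw [ZL_eq]
  have hgH1 : MemH1 g := fun w hw => (hg w hw).1
  have hG : GoodR R (harmLin f g - shIdxLin f g) := by
    rw [sub_eq_add_neg, ← neg_one_smul ℚ]
    refine GoodR.add R (GoodR.harm R hR0 hRmul (good_H1 R hR0 hRfix hRe1 hRmul f hf)
      (good_H1 R hR0 hRfix hRe1 hRmul g hgH1)) (GoodR.smul R _ ?_)
    exact good_H1 R hR0 hRfix hRe1 hRmul _ (memH1_shIdx f g)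
  obtain ⟨P, h1, h2⟩ := hG
  rw [← h1]
  have h3 : Filter.Tendsto (fun N => P.eval (hh N)) Filter.atTop (nhds 0) := by
    have := (main_tendsto f g hf hg).sub h2.tendsto
    simpa using this
  by_cases hd : 0 < P.degree
  · exfalso
    have h4 := (P.abs_tendsto_atTop hd).comp hh_tendsto
    exact not_tendsto_nhds_of_tendsto_atTop h4 _ h3.abs
  · have hP := Polynomial.eq_C_of_degree_le_zero (not_lt.mp hd)
    rw [hP] at h3 ⊢
    simp only [Polynomial.eval_C] at h3 ⊢
    exact tendsto_nhds_unique tendsto_const_nhds h3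
end
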